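/- Let a ∈ A^m(ℝⁿ×ℝⁿ;𝒜_θ), m ∈ ℝ. For every integer N > m+2n, the map (s,ξ) ↦ e^{is·ξ}(L^t)^N[a(s,ξ)] is Bochner integrable as an A_θ-valued map on ℝⁿ×ℝⁿ, and the element J(a) := (2π)^{−n} ∬ e^{is·ξ}(L^t)^N[a(s,ξ)] ds dξ of A_θ does not depend on the choice of the integer N > m+2n. Moreover: J(a) ∈ 𝒜_θ; if m < −2n then J(a) = (2π)^{−n} ∬ e^{is·ξ} a(s,ξ) ds dξ; and J is continuous on A^m, i.e. for every α ∈ ℕ₀ⁿ there are N' ∈ ℕ₀ and C > 0 such that ‖δ^α(J(a))‖ ≤ C q_{N'}^{(m)}(a) for all a ∈ A^m(ℝⁿ×ℝⁿ;𝒜_θ). -/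

import Mathlib

open Complex Filter Topology
open scoped ComplexOrder Real BigOperators

noncomputable section

/-- Euclidean space `ℝⁿ`. -/
abbrev Rn (n : ℕ) : Type := EuclideanSpace ℝ (Fin n)

/-- `ℝⁿ × ℝⁿ`. -/
abbrev R2n (n : ℕ) : Type := Rn n × Rn n

/-- Length `|β|` of a multi-order `β ∈ ℕ₀ⁿ`. -/
def mdeg {n : ℕ} (b : Fin n → ℕ) : ℕ := ∑ j, b j

/-- Composition of a list of self-maps. -/
def compList {X : Type*} (l : List (X → X)) : X → X := l.foldr (· ∘ ·) id

/-- The phase `c(k,l) = Σ_{q<p} k_p θ_{pq} l_q`. -/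
def cPhase {n : ℕ} (θ : Matrix (Fin n) (Fin n) ℝ) (k l : Fin n → ℤ) : ℝ :=
  ∑ p, ∑ q, if q < p then (k p : ℝ) * θ p q * (l q : ℝ) else 0

/-- Euclidean norm `|k|` of a lattice point `k ∈ ℤⁿ`. -/
def znorm {n : ℕ} (k : Fin n → ℤ) : ℝ := Real.sqrt (∑ j, ((k j : ℝ)) ^ 2)

/-- `k^β = ∏ k_jᵝ`. -/
def kpow {n : ℕ} (b : Fin n → ℕ) (k : Fin n → ℤ) : ℝ := ∏ j, ((k j : ℝ)) ^ (b j)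

/-- A lattice point `k ∈ ℤⁿ` viewed as a point of `ℝⁿ`. -/
def zEmb {n : ℕ} (k : Fin n → ℤ) : Rn n := (WithLp.equiv 2 (Fin n → ℝ)).symm (fun j => (k j : ℝ))

variable {n : ℕ} {A : Type} [NormedRing A] [StarRing A] [CStarRing A]
  [NormedAlgebra ℂ A] [StarModule ℂ A] [CompleteSpace A]

/-- The derivation `δ_j u = (1/i) ∂_{s_j} α_s(u)|_{s=0}`. -/
def δd (αa : Rn n → (A ≃⋆ₐ[ℂ] A)) (j : Fin n) (u : A) : A :=
  (-Complex.I) • fderiv ℝ (fun s : Rn n => αa s u) 0 (EuclideanSpace.single j 1)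

/-- `δ^β = δ_1^{β_1} ⋯ δ_n^{β_n}`. -/
def δpow (αa : Rn n → (A ≃⋆ₐ[ℂ] A)) (b : Fin n → ℕ) : A → A :=
  compList (List.ofFn fun j => (δd αa j)^[b j])

/-- The smooth noncommutative torus `𝒜_θ`: elements with `C^∞` orbit map. -/
def SmoothSet (αa : Rn n → (A ≃⋆ₐ[ℂ] A)) : Set A :=
  {u | ∀ N : ℕ, ContDiff ℝ N (fun s : Rn n => αa s u)}

/-- `A_θ^{(N)}`: elements with `C^N` orbit map. -/
def CNSet (αa : Rn n → (A ≃⋆ₐ[ℂ] A)) (N : ℕ) : Set A :=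
  {u | ContDiff ℝ N (fun s : Rn n => αa s u)}

/-- The Fréchet seminorms `‖u‖_{(N)} = sup_{|β| ≤ N} ‖δ^β(u)‖` of `𝒜_θ`. -/
def frSemi (αa : Rn n → (A ≃⋆ₐ[ℂ] A)) (N : ℕ) (u : A) : ℝ :=
  ⨆ b : {b : Fin n → ℕ // mdeg b ≤ N}, ‖δpow αa b.1 u‖

/-- Partial derivative `∂_{ξ_j}` of maps `ℝⁿ → A`. -/
def pd {n : ℕ} (j : Fin n) (f : Rn n → A) : Rn n → A :=
  fun ξ => fderiv ℝ f ξ (EuclideanSpace.single j 1)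

/-- Iterated partial derivative `∂_ξ^β` of maps `ℝⁿ → A`. -/
def pdPow {n : ℕ} (b : Fin n → ℕ) : (Rn n → A) → (Rn n → A) :=
  compList (List.ofFn fun j => (pd j)^[b j])

/-- Partial derivative `∂_{s_j}` (first variable) of maps `ℝⁿ×ℝⁿ → A`. -/
def pdS {n : ℕ} (j : Fin n) (f : R2n n → A) : R2n n → A :=
  fun x => fderiv ℝ f x (EuclideanSpace.single j 1, 0)

/-- Partial derivative `∂_{ξ_j}` (second variable) of maps `ℝⁿ×ℝⁿ → A`. -/
def pdXi {n : ℕ} (j : Fin n) (f : R2n n → A) : R2n n → A :=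
  fun x => fderiv ℝ f x (0, EuclideanSpace.single j 1)

/-- `∂_s^β`. -/
def pdSPow {n : ℕ} (b : Fin n → ℕ) : (R2n n → A) → (R2n n → A) :=
  compList (List.ofFn fun j => (pdS j)^[b j])

/-- `∂_ξ^γ`. -/
def pdXiPow {n : ℕ} (b : Fin n → ℕ) : (R2n n → A) → (R2n n → A) :=
  compList (List.ofFn fun j => (pdXi j)^[b j])

/-- Forward difference operator `Δ_j` on maps `ℝⁿ → A`. -/
def fdiff {n : ℕ} (j : Fin n) (f : Rn n → A) : Rn n → A :=
  fun ξ => f (ξ + EuclideanSpace.single j 1) - f ξ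

/-- `Δ^β` on maps `ℝⁿ → A`. -/
def fdiffPow {n : ℕ} (b : Fin n → ℕ) : (Rn n → A) → (Rn n → A) :=
  compList (List.ofFn fun j => (fdiff j)^[b j])

/-- Forward difference operator `Δ_j` on sequences `ℤⁿ → A`. -/
def zdiff {n : ℕ} (j : Fin n) (f : (Fin n → ℤ) → A) : (Fin n → ℤ) → A :=
  fun k => f (k + Pi.single j 1) - f k

/-- `Δ^β` on sequences `ℤⁿ → A`. -/
def zdiffPow {n : ℕ} (b : Fin n → ℕ) : ((Fin n → ℤ) → A) → ((Fin n → ℤ) → A) :=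
  compList (List.ofFn fun j => (zdiff j)^[b j])

/-- The symbol class `𝕊^m(ℝⁿ; 𝒜_θ)`. -/
def IsSymbol (αa : Rn n → (A ≃⋆ₐ[ℂ] A)) (m : ℝ) (ρ : Rn n → A) : Prop :=
  (∀ ξ, ρ ξ ∈ SmoothSet αa) ∧
  (∀ a : Fin n → ℕ, ∀ N : ℕ, ContDiff ℝ N fun ξ => δpow αa a (ρ ξ)) ∧
  (∀ a b : Fin n → ℕ, ∃ C > 0, ∀ ξ,
    ‖δpow αa a (pdPow b ρ ξ)‖ ≤ C * (1 + ‖ξ‖) ^ (m - (mdeg b : ℝ)))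

/-- The class `𝒮(ℝⁿ; 𝒜_θ) = ∩ₘ 𝕊^m(ℝⁿ; 𝒜_θ)`. -/
def IsSchwartzSym (αa : Rn n → (A ≃⋆ₐ[ℂ] A)) (ρ : Rn n → A) : Prop :=
  ∀ m : ℝ, IsSymbol αa m ρ

/-- The seminorm `p_N^{(m)}` on `𝕊^m(ℝⁿ; 𝒜_θ)`. -/
def pSemi (αa : Rn n → (A ≃⋆ₐ[ℂ] A)) (m : ℝ) (N : ℕ) (ρ : Rn n → A) : ℝ :=
  ⨆ q : {ab : (Fin n → ℕ) × (Fin n → ℕ) // mdeg ab.1 + mdeg ab.2 ≤ N} × Rn n,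
    (1 + ‖q.2‖) ^ (-m + (mdeg q.1.1.2 : ℝ)) * ‖δpow αa q.1.1.1 (pdPow q.1.1.2 ρ q.2)‖

/-- The amplitude class `A^m(ℝⁿ×ℝⁿ; 𝒜_θ)`. -/
def IsAmplitude (αa : Rn n → (A ≃⋆ₐ[ℂ] A)) (m : ℝ) (a : R2n n → A) : Prop :=
  (∀ x, a x ∈ SmoothSet αa) ∧
  (∀ c : Fin n → ℕ, ∀ N : ℕ, ContDiff ℝ N fun x => δpow αa c (a x)) ∧
  (∀ c b g : Fin n → ℕ, ∃ C > 0, ∀ x : R2n n,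
    ‖δpow αa c (pdSPow b (pdXiPow g a) x)‖ ≤ C * (1 + ‖x.1‖ + ‖x.2‖) ^ m)

/-- The seminorm `q_N^{(m)}` on `A^m(ℝⁿ×ℝⁿ; 𝒜_θ)`. -/
def qSemi (αa : Rn n → (A ≃⋆ₐ[ℂ] A)) (m : ℝ) (N : ℕ) (a : R2n n → A) : ℝ :=
  ⨆ q : {t : (Fin n → ℕ) × (Fin n → ℕ) × (Fin n → ℕ) //
      mdeg t.1 + mdeg t.2.1 + mdeg t.2.2 ≤ N} × R2n n,
    (1 + ‖q.2.1‖ + ‖q.2.2‖) ^ (-m) *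
      ‖δpow αa q.1.1.1 (pdSPow q.1.1.2.1 (pdXiPow q.1.1.2.2 a) q.2)‖

/-- The toroidal symbol class `𝕊^m(ℤⁿ; 𝒜_θ)`. -/
def IsToroidal (αa : Rn n → (A ≃⋆ₐ[ℂ] A)) (m : ℝ) (ρ : (Fin n → ℤ) → A) : Prop :=
  (∀ k, ρ k ∈ SmoothSet αa) ∧
  (∀ a b : Fin n → ℕ, ∃ C > 0, ∀ k,
    ‖δpow αa a (zdiffPow b ρ k)‖ ≤ C * (1 + znorm k) ^ (m - (mdeg b : ℝ)))

/-- The coefficient `(1-χ)/(|s|²+|ξ|²)` of the operator `L`. -/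
def Lcoef {n : ℕ} (χc : R2n n → ℝ) (x : R2n n) : ℝ := (1 - χc x) / (‖x.1‖ ^ 2 + ‖x.2‖ ^ 2)

/-- The transpose `L^t` of `L = χ + (1-χ)(|s|²+|ξ|²)^{-1} Σ (ξ_j D_{s_j} + s_j D_{ξ_j})`,
namely `L^t u = χ u - Σ_j (D_{s_j}((1-χ)(|s|²+|ξ|²)^{-1} ξ_j u) + D_{ξ_j}(… s_j u))`. -/
def Ltrans (χc : R2n n → ℝ) (u : R2n n → A) : R2n n → A := fun x =>
  χc x • u x -
    ∑ j, ((-Complex.I) • pdS j (fun y => (Lcoef χc y * y.2 j) • u y) x +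
      (-Complex.I) • pdXi j (fun y => (Lcoef χc y * y.1 j) • u y) x)

/-- The (regularized) oscillating integral `(2π)^{-n} ∬ e^{is·ξ} (L^t)^N[a(s,ξ)] ds dξ`. -/
def Josc (χc : R2n n → ℝ) (N : ℕ) (a : R2n n → A) : A :=
  ((2 * Real.pi) ^ n)⁻¹ •
    MeasureTheory.integral MeasureTheory.volume
      (fun x : R2n n => Complex.exp (Complex.I * ((∑ j, x.1 j * x.2 j : ℝ) : ℂ)) •
        ((Ltrans χc)^[N] a) x)

/-- A convenient integer `> m + 2n`. -/
def Nfor (n : ℕ) (m : ℝ) : ℕ := ⌈m⌉₊ + 2 * n + 1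

open scoped ContDiff

set_option linter.unusedSectionVars false

/-! ### Ordered compositions of powers of operators -/

/-- The ordered composition `T₁^{b₁} ⋯ Tₙ^{bₙ}`. -/
def powComp {X : Type*} {k : ℕ} (T : Fin k → X → X) (b : Fin k → ℕ) : X → X :=
  compList (List.ofFn fun j => (T j)^[b j])

lemma powComp_zero_left {X : Type*} (T : Fin 0 → X → X) (b : Fin 0 → ℕ) : powComp T b = id := by
  simp [powComp, compList]

lemma powComp_zero_right {X : Type*} {k : ℕ} (T : Fin k → X → X) : powComp T 0 = id := by
  induction k with
  | zero => exact powComp_zero_left _ _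
  | succ k ih =>
    have := ih (fun j => T j.succ)
    simp only [powComp, compList, List.ofFn_succ, List.foldr_cons, Pi.zero_apply,
      Function.iterate_zero] at this ⊢
    simpa using this

lemma powComp_succ {X : Type*} {k : ℕ} (T : Fin (k + 1) → X → X) (b : Fin (k + 1) → ℕ) (x : X) :
    powComp T b x = (T 0)^[b 0] (powComp (fun j => T j.succ) (fun j => b j.succ) x) := by
  simp [powComp, compList, List.ofFn_succ]

lemma iterate_semiconj_on {X Y : Type*} {T : X → X} {T' : Y → Y} {φ : Y → X} {S : Set Y}
    (hS : ∀ y ∈ S, T' y ∈ S) (h : ∀ y ∈ S, T (φ y) = φ (T' y)) (r : ℕ) :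
    ∀ y ∈ S, T^[r] (φ y) = φ (T'^[r] y) ∧ T'^[r] y ∈ S := by
  induction r with
  | zero => intro y hy; exact ⟨rfl, hy⟩
  | succ r ih =>
    intro y hy
    simp only [Function.iterate_succ, Function.comp_apply]
    rw [h y hy]
    exact ih _ (hS y hy)

/-- Operators intertwined by `φ` on an invariant set have intertwined ordered compositions. -/
lemma powComp_semiconj_on {X Y : Type*} {k : ℕ} {T : Fin k → X → X} {T' : Fin k → Y → Y}
    {φ : Y → X} {S : Set Y} (hS : ∀ j, ∀ y ∈ S, T' j y ∈ S)
    (h : ∀ j, ∀ y ∈ S, T j (φ y) = φ (T' j y)) (b : Fin k → ℕ) :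
    ∀ y ∈ S, powComp T b (φ y) = φ (powComp T' b y) ∧ powComp T' b y ∈ S := by
  induction k with
  | zero => intro y hy; simp [powComp_zero_left, hy]
  | succ k ih =>
    intro y hy
    obtain ⟨h1, h2⟩ := ih (T := fun j => T j.succ) (T' := fun j => T' j.succ)
      (fun j => hS j.succ) (fun j => h j.succ) (fun j => b j.succ) y hy
    rw [powComp_succ, powComp_succ, h1]
    exact iterate_semiconj_on (hS 0) (h 0) (b 0) _ h2

lemma powComp_mem {X : Type*} {k : ℕ} {T : Fin k → X → X} {S : Set X}
    (hS : ∀ j, ∀ y ∈ S, T j y ∈ S) (b : Fin k → ℕ) {y : X} (hy : y ∈ S) : powComp T b y ∈ S :=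
  (powComp_semiconj_on (T := T) (φ := id) hS (fun _ _ _ => rfl) b y hy).2

/-- For operators commuting on an invariant set, composing with one of them raises the
corresponding exponent. -/
lemma powComp_apply_eq {X : Type*} {k : ℕ} {T : Fin k → X → X} {S : Set X}
    (hS : ∀ j, ∀ y ∈ S, T j y ∈ S)
    (hc : ∀ i j, ∀ y ∈ S, T i (T j y) = T j (T i y)) (b : Fin k → ℕ) (i : Fin k) :
    ∀ y ∈ S, powComp T b (T i y) = powComp T (b + Pi.single i 1) y := by
  induction k with
  | zero => exact i.elim0
  | succ k ih =>
    intro y hy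
    rw [powComp_succ, powComp_succ]
    refine Fin.cases ?_ (fun i => ?_) i
    · have h1 := powComp_semiconj_on (T := fun j : Fin k => T j.succ) (T' := fun j => T j.succ)
        (φ := T 0) (S := S) (fun j => hS j.succ) (fun j z hz => hc _ _ z hz)
        (fun j => b j.succ) y hy
      rw [h1.1]
      have e0 : (b + Pi.single 0 1 : Fin (k + 1) → ℕ) 0 = b 0 + 1 := by simp
      have e1 : (fun j : Fin k => (b + Pi.single 0 1 : Fin (k + 1) → ℕ) j.succ)
          = fun j => b j.succ := by
        ext j; simp [Fin.succ_ne_zero]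
      rw [e0, e1, Function.iterate_succ_apply]
    · have e0 : (b + Pi.single i.succ 1 : Fin (k + 1) → ℕ) 0 = b 0 := by
        simp [(Fin.succ_ne_zero i).symm]
      have e1 : (fun j : Fin k => (b + Pi.single i.succ 1 : Fin (k + 1) → ℕ) j.succ)
          = (fun j => b j.succ) + Pi.single i 1 := by
        ext j; simp [Pi.single_apply, Fin.succ_inj]
      rw [e0, e1, ih (T := fun j => T j.succ) (fun j => hS j.succ)
        (fun i j => hc i.succ j.succ) (fun j => b j.succ) i y hy]

lemma apply_powComp_eq {X : Type*} {k : ℕ} {T : Fin k → X → X} {S : Set X}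
    (hS : ∀ j, ∀ y ∈ S, T j y ∈ S)
    (hc : ∀ i j, ∀ y ∈ S, T i (T j y) = T j (T i y)) (b : Fin k → ℕ) (i : Fin k) {y : X}
    (hy : y ∈ S) : T i (powComp T b y) = powComp T (b + Pi.single i 1) y := by
  rw [← powComp_apply_eq hS hc b i y hy]
  exact ((powComp_semiconj_on hS (fun j z hz => hc j i z hz) b y hy).1).symm

lemma mdeg_add_single (b : Fin n → ℕ) (i : Fin n) : mdeg (b + Pi.single i 1) = mdeg b + 1 := by
  simp [mdeg, Finset.sum_add_distrib]

/-! ### Directional derivatives -/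

section DirDeriv

variable {V E : Type*} [NormedAddCommGroup V] [NormedSpace ℝ V]
  [NormedAddCommGroup E] [NormedSpace ℝ E]

/-- The derivative of `f` in the direction `v`. -/
def dirDeriv (v : V) (f : V → E) : V → E := fun x => fderiv ℝ f x v

lemma ContDiff.dirDeriv {f : V → E} (hf : ContDiff ℝ ∞ f) (v : V) :
    ContDiff ℝ ∞ (dirDeriv v f) :=
  (hf.fderiv_right (m := ∞) (by simp)).clm_apply contDiff_const

lemma dirDeriv_comm {f : V → E} (hf : ContDiff ℝ ∞ f) (v w : V) :
    dirDeriv v (dirDeriv w f) = dirDeriv w (dirDeriv v f) := by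
  have hd : Differentiable ℝ (fderiv ℝ f) :=
    (hf.fderiv_right (m := ∞) (by simp)).differentiable (by simp)
  have key : ∀ (v w : V) (x : V),
      dirDeriv v (dirDeriv w f) x = fderiv ℝ (fderiv ℝ f) x v w := by
    intro v w x
    unfold dirDeriv
    rw [fderiv_clm_apply (hd x) (differentiableAt_const w)]
    simp
  ext x
  rw [key, key]
  exact (contDiff_infty.1 hf 2).contDiffAt.isSymmSndFDerivAt (by simp) v w

lemma ContDiff.differentiable_of_infty {f : V → E} (hf : ContDiff ℝ ∞ f) : Differentiable ℝ f :=
  hf.differentiable (by simp)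

lemma dirDeriv_add {f g : V → E} (hf : Differentiable ℝ f) (hg : Differentiable ℝ g) (v : V) :
    dirDeriv v (fun x => f x + g x) = fun x => dirDeriv v f x + dirDeriv v g x := by
  ext x; simp [dirDeriv, fderiv_fun_add (hf x) (hg x)]

lemma dirDeriv_smul {r : V → ℝ} {f : V → E} (hr : Differentiable ℝ r) (hf : Differentiable ℝ f)
    (v : V) :
    dirDeriv v (fun x => r x • f x) = fun x => r x • dirDeriv v f x + dirDeriv v r x • f x := by
  ext x; simp [dirDeriv, fderiv_fun_smul (hr x) (hf x)]

lemma dirDeriv_const_smul [NormedSpace ℂ E] (c : ℂ) {f : V → E} (hf : Differentiable ℝ f) (v : V) :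
    dirDeriv v (fun x => c • f x) = fun x => c • dirDeriv v f x := by
  ext x; simp [dirDeriv, fderiv_fun_const_smul (hf x)]

end DirDeriv

/-! ### Isometric actions and their derivations -/

/-- `s ↦ αa s` is an action of `ℝⁿ` by isometric automorphisms. -/
structure IsIsomAction (αa : Rn n → (A ≃⋆ₐ[ℂ] A)) : Prop where
  map_add : ∀ s t (u : A), αa (s + t) u = αa s (αa t u)
  map_zero : ∀ u : A, αa 0 u = u
  norm_map : ∀ s (u : A), ‖αa s u‖ = ‖u‖

/-- The real-linear isometry underlying `αa s`. -/
def IsIsomAction.toCLM {αa : Rn n → (A ≃⋆ₐ[ℂ] A)} (h : IsIsomAction αa) (s : Rn n) : A →L[ℝ] A :=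
  LinearMap.mkContinuous
    { toFun := αa s
      map_add' := fun x y => _root_.map_add (αa s) x y
      map_smul' := fun r x => by
        rw [← Complex.coe_smul, map_smul, RingHom.id_apply, Complex.coe_smul] } 1
    (fun u => by rw [one_mul]; exact (h.norm_map s u).le)

@[simp] lemma IsIsomAction.toCLM_apply {αa : Rn n → (A ≃⋆ₐ[ℂ] A)} (h : IsIsomAction αa)
    (s : Rn n) (u : A) : h.toCLM s u = αa s u := rfl

/-- The real-linear map `ℝⁿ → A` sending `e_j` to `i u_j`. -/
def orbitDeriv (u' : Fin n → A) : Rn n →L[ℝ] A :=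
  ∑ j, (EuclideanSpace.proj j : Rn n →L[ℝ] ℝ).smulRight (Complex.I • u' j)

lemma orbitDeriv_apply (u' : Fin n → A) (v : Rn n) :
    orbitDeriv u' v = ∑ j, v j • Complex.I • u' j := by
  simp [orbitDeriv]

lemma orbitDeriv_single (u' : Fin n → A) (j : Fin n) :
    orbitDeriv u' (EuclideanSpace.single j 1) = Complex.I • u' j := by
  rw [orbitDeriv_apply, Finset.sum_eq_single j]
  · simp
  · intro i _ hi; simp [hi]
  · simp

lemma orbitDeriv_add (u v : Fin n → A) :
    orbitDeriv (fun j => u j + v j) = orbitDeriv u + orbitDeriv v := by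
  ext x; simp [orbitDeriv_apply, Finset.sum_add_distrib]

lemma orbitDeriv_sub (u v : Fin n → A) :
    orbitDeriv (fun j => u j - v j) = orbitDeriv u - orbitDeriv v := by
  ext x; simp [orbitDeriv_apply, smul_sub]

lemma orbitDeriv_smul (c : ℂ) (u : Fin n → A) :
    orbitDeriv (fun j => c • u j) = c • orbitDeriv u := by
  ext x; simp only [orbitDeriv_apply, smul_apply, Finset.smul_sum]
  refine Finset.sum_congr rfl fun j _ => ?_
  rw [smul_comm c, smul_comm c]

lemma norm_orbitDeriv_le (u : Fin n → A) : ‖orbitDeriv u‖ ≤ ∑ j, ‖u j‖ := by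
  refine ContinuousLinearMap.opNorm_le_bound _ (by positivity) fun v => ?_
  rw [orbitDeriv_apply, Finset.sum_mul]
  refine (norm_sum_le _ _).trans (Finset.sum_le_sum fun j _ => ?_)
  rw [norm_smul, norm_smul, Complex.norm_I, one_mul, mul_comm]
  gcongr
  exact PiLp.norm_apply_le v j

lemma ContDiff.orbitDeriv {V : Type*} [NormedAddCommGroup V] [NormedSpace ℝ V] {k : WithTop ℕ∞}
    {u : Fin n → V → A} (hu : ∀ j, ContDiff ℝ k (u j)) :
    ContDiff ℝ k fun x => orbitDeriv fun j => u j x :=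
  ContDiff.sum fun j _ => contDiff_const.smulRight ((hu j).const_smul Complex.I)

/-- The orbit map of `u` is differentiable at `0` with partial derivatives `i u_j`. -/
def HasOrbitDeriv (αa : Rn n → (A ≃⋆ₐ[ℂ] A)) (u : A) (u' : Fin n → A) : Prop :=
  HasFDerivAt (fun s => αa s u) (orbitDeriv u') 0

section Action

variable {αa : Rn n → (A ≃⋆ₐ[ℂ] A)}

lemma HasOrbitDeriv.δd_eq {u : A} {u' : Fin n → A} (h : HasOrbitDeriv αa u u') (j : Fin n) :
    δd αa j u = u' j := by
  unfold δd
  rw [HasFDerivAt.fderiv h, orbitDeriv_single, smul_smul]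
  simp

lemma hasOrbitDeriv_of_differentiableAt {u : A}
    (h : DifferentiableAt ℝ (fun s => αa s u) 0) :
    HasOrbitDeriv αa u fun j => δd αa j u := by
  unfold HasOrbitDeriv
  convert h.hasFDerivAt using 1
  refine ContinuousLinearMap.ext fun v => ?_
  have hv : v = ∑ j, v j • EuclideanSpace.single j (1 : ℝ) := by
    ext i; simp [Finset.sum_apply, Pi.single_apply]
  conv_rhs => rw [hv, map_sum]
  rw [orbitDeriv_apply]
  refine Finset.sum_congr rfl fun j _ => ?_
  rw [map_smul, δd, smul_smul]
  simp

lemma HasOrbitDeriv.add {u v : A} {u' v' : Fin n → A} (hu : HasOrbitDeriv αa u u')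
    (hv : HasOrbitDeriv αa v v') : HasOrbitDeriv αa (u + v) fun j => u' j + v' j := by
  unfold HasOrbitDeriv at *
  simpa only [map_add, orbitDeriv_add] using hu.fun_add hv

lemma HasOrbitDeriv.sub {u v : A} {u' v' : Fin n → A} (hu : HasOrbitDeriv αa u u')
    (hv : HasOrbitDeriv αa v v') : HasOrbitDeriv αa (u - v) fun j => u' j - v' j := by
  unfold HasOrbitDeriv at *
  simpa only [map_sub, orbitDeriv_sub] using hu.fun_sub hv

lemma HasOrbitDeriv.const_smul (c : ℂ) {u : A} {u' : Fin n → A} (hu : HasOrbitDeriv αa u u') :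
    HasOrbitDeriv αa (c • u) fun j => c • u' j := by
  unfold HasOrbitDeriv at *
  simpa only [map_smul, orbitDeriv_smul] using hu.fun_const_smul c

lemma HasOrbitDeriv.hasFDerivAt (hα : IsIsomAction αa) {u : A} {u' : Fin n → A}
    (hu : HasOrbitDeriv αa u u') (t : Rn n) :
    HasFDerivAt (fun s => αa s u) (orbitDeriv fun j => αa t (u' j)) t := by
  have h1 : HasFDerivAt (fun s => αa s u) (orbitDeriv u') (t - t) := by
    rw [sub_self]; exact hu
  have h2 := (hα.toCLM t).hasFDerivAt.comp t
    (HasFDerivAt.comp (f := fun s => s - t) t h1 ((hasFDerivAt_id t).sub_const t))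
  have e1 : hα.toCLM t ∘ (fun s => αa s u) ∘ (fun s => s - t) = fun s => αa s u := by
    ext s
    simp [← hα.map_add]
  have e2 : (hα.toCLM t).comp ((orbitDeriv u').comp (ContinuousLinearMap.id ℝ (Rn n))) =
      orbitDeriv fun j => αa t (u' j) := by
    refine ContinuousLinearMap.ext fun v => ?_
    simp only [ContinuousLinearMap.comp_apply, ContinuousLinearMap.id_apply, orbitDeriv_apply,
      map_sum, hα.toCLM_apply]
    refine Finset.sum_congr rfl fun j _ => ?_
    rw [← hα.toCLM_apply, map_smul, hα.toCLM_apply, map_smul]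
  rwa [e1, e2] at h2

/-- A set on which orbit maps are differentiable, with partial derivatives again in the set,
consists of smooth elements. -/
lemma subset_smoothSet (hα : IsIsomAction αa) {S : Set A}
    (hS : ∀ u ∈ S, ∃ u' : Fin n → A, (∀ j, u' j ∈ S) ∧ HasOrbitDeriv αa u u') :
    S ⊆ SmoothSet αa := by
  have key : ∀ N : ℕ, ∀ u ∈ S, ContDiff ℝ N (fun s : Rn n => αa s u) := by
    intro N
    induction N with
    | zero =>
      intro u hu
      obtain ⟨u', -, h⟩ := hS u hu
      exact contDiff_zero.2 (continuous_iff_continuousAt.2 fun t =>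
        (h.hasFDerivAt hα t).continuousAt)
    | succ N ih =>
      intro u hu
      obtain ⟨u', h', h⟩ := hS u hu
      exact contDiff_succ_iff_hasFDerivAt.2
        ⟨_, ContDiff.orbitDeriv fun j => ih _ (h' j), h.hasFDerivAt hα⟩
  exact fun u hu N => key N u hu

lemma contDiff_orbit {u : A} (hu : u ∈ SmoothSet αa) : ContDiff ℝ ∞ (fun s => αa s u) :=
  contDiff_infty.2 hu

lemma hasOrbitDeriv_of_mem {u : A} (hu : u ∈ SmoothSet αa) :
    HasOrbitDeriv αa u fun j => δd αa j u :=
  hasOrbitDeriv_of_differentiableAt ((contDiff_orbit hu).differentiable_of_infty 0)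

lemma orbit_δd (hα : IsIsomAction αa) {u : A} (hu : u ∈ SmoothSet αa) (j : Fin n) :
    (fun s => αa s (δd αa j u)) =
      fun s => (-Complex.I) • dirDeriv (EuclideanSpace.single j 1) (fun s => αa s u) s := by
  ext t
  rw [dirDeriv, ((hasOrbitDeriv_of_mem hu).hasFDerivAt hα t).fderiv, orbitDeriv_single, smul_smul]
  simp

lemma δd_mem (hα : IsIsomAction αa) (j : Fin n) {u : A} (hu : u ∈ SmoothSet αa) :
    δd αa j u ∈ SmoothSet αa := by
  refine contDiff_infty.1 ?_
  rw [orbit_δd hα hu]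
  exact ((contDiff_orbit hu).dirDeriv _).const_smul _

lemma δd_comm (hα : IsIsomAction αa) (i j : Fin n) {u : A} (hu : u ∈ SmoothSet αa) :
    δd αa i (δd αa j u) = δd αa j (δd αa i u) := by
  have key : ∀ i j : Fin n, δd αa i (δd αa j u) = (-Complex.I) • (-Complex.I) •
      dirDeriv (EuclideanSpace.single i 1)
        (dirDeriv (EuclideanSpace.single j 1) (fun s => αa s u)) 0 := by
    intro i j
    change (-Complex.I) • dirDeriv (EuclideanSpace.single i 1) (fun s => αa s (δd αa j u)) 0 = _
    rw [orbit_δd hα hu, dirDeriv_const_smul _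
      ((contDiff_orbit hu).dirDeriv _).differentiable_of_infty]
  rw [key, key, dirDeriv_comm (contDiff_orbit hu)]

lemma δpow_δd (hα : IsIsomAction αa) (c : Fin n → ℕ) (j : Fin n) {u : A}
    (hu : u ∈ SmoothSet αa) : δpow αa c (δd αa j u) = δpow αa (c + Pi.single j 1) u :=
  powComp_apply_eq (fun j _ hy => δd_mem hα j hy) (fun i j _ hy => δd_comm hα i j hy) c j u hu

/-- The derivations are closed: they commute with directional derivatives of functions. -/
lemma hasOrbitDeriv_dirDeriv (hα : IsIsomAction αa) {V : Type*} [NormedAddCommGroup V]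
    [NormedSpace ℝ V] {a : V → A} (v x : V) (ha : DifferentiableAt ℝ a x)
    (hO : ∀ y, DifferentiableAt ℝ (fun s => αa s (a y)) 0)
    (hδ : ∀ j, DifferentiableAt ℝ (fun y => δd αa j (a y)) x) :
    HasOrbitDeriv αa (dirDeriv v a x) fun j => dirDeriv v (fun y => δd αa j (a y)) x := by
  have slope : ∀ {f : V → A}, DifferentiableAt ℝ f x →
      Tendsto (fun h : ℝ => h⁻¹ • (f (x + h • v) - f x)) (𝓝[≠] 0) (𝓝 (dirDeriv v f x)) :=
    fun hf => (hf.hasFDerivAt.hasLineDerivAt v).tendsto_slope_zero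
  set q : ℝ → Fin n → A :=
    fun h j => h⁻¹ • (δd αa j (a (x + h • v)) - δd αa j (a x)) with hq
  set q₀ : Fin n → A := fun j => dirDeriv v (fun y => δd αa j (a y)) x with hq₀
  have hquot : ∀ h : ℝ, HasOrbitDeriv αa (h⁻¹ • (a (x + h • v) - a x)) (q h) := by
    intro h
    have := ((hasOrbitDeriv_of_differentiableAt (hO (x + h • v))).sub
      (hasOrbitDeriv_of_differentiableAt (hO x))).const_smul ((h⁻¹ : ℝ) : ℂ)
    simpa only [Complex.coe_smul] using this
  have hmain := hasFDerivAt_of_tendstoUniformlyOnFilter (𝕜 := ℝ) (l := 𝓝[≠] (0 : ℝ))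
    (x := (0 : Rn n))
    (f := fun h t => αa t (h⁻¹ • (a (x + h • v) - a x)))
    (f' := fun h t => orbitDeriv fun j => αa t (q h j))
    (g := fun t => αa t (dirDeriv v a x))
    (g' := fun t => orbitDeriv fun j => αa t (q₀ j)) ?_ ?_ ?_
  · simpa only [HasOrbitDeriv, hα.map_zero] using hmain
  · rw [Metric.tendstoUniformlyOnFilter_iff]
    intro ε hε
    have h0 : Tendsto (fun h : ℝ => ∑ j, ‖q₀ j - q h j‖) (𝓝[≠] 0) (𝓝 0) := by
      have : Tendsto (fun h : ℝ => ∑ j, ‖q₀ j - q h j‖) (𝓝[≠] 0)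
          (𝓝 (∑ j, ‖q₀ j - q₀ j‖)) :=
        tendsto_finsetSum _ fun j _ => (tendsto_const_nhds.sub (slope (hδ j))).norm
      simpa using this
    have h1 : ∀ᶠ h in 𝓝[≠] (0 : ℝ), ∑ j, ‖q₀ j - q h j‖ < ε := h0.eventually_lt_const hε
    refine (h1.prod_inl (𝓝 (0 : Rn n))).mono fun p hp => ?_
    refine lt_of_le_of_lt ?_ hp
    rw [dist_eq_norm, ← orbitDeriv_sub]
    refine (norm_orbitDeriv_le _).trans (Finset.sum_le_sum fun j _ => ?_)
    rw [← map_sub, hα.norm_map]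
  · exact Eventually.of_forall fun p => (hquot p.1).hasFDerivAt hα p.2
  · exact Eventually.of_forall fun t =>
      ((hα.toCLM t).continuous.tendsto _).comp (slope ha)

end Action

/-! ### Smooth functions with values in the smooth elements -/

section SmoothFun

variable {V : Type*} [NormedAddCommGroup V] [NormedSpace ℝ V] {αa : Rn n → (A ≃⋆ₐ[ℂ] A)}

/-- Smooth maps into `𝒜_θ`. -/
structure IsSmoothFun (αa : Rn n → (A ≃⋆ₐ[ℂ] A)) (a : V → A) : Prop where
  mem : ∀ x, a x ∈ SmoothSet αa
  contDiff_δpow : ∀ c : Fin n → ℕ, ContDiff ℝ ∞ fun x => δpow αa c (a x)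

/-- `a` and the `a' j` are smooth, and the `a' j` are the derivations of `a`. -/
structure HasDerivations (αa : Rn n → (A ≃⋆ₐ[ℂ] A)) (a : V → A) (a' : Fin n → V → A) :
    Prop where
  contDiff : ContDiff ℝ ∞ a
  contDiff' : ∀ j, ContDiff ℝ ∞ (a' j)
  hasOrbitDeriv : ∀ x, HasOrbitDeriv αa (a x) fun j => a' j x

lemma δpow_zero (u : A) : δpow αa 0 u = u := congrFun (powComp_zero_right _) u

lemma IsSmoothFun.contDiff {a : V → A} (ha : IsSmoothFun αa a) : ContDiff ℝ ∞ a := by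
  simpa only [δpow_zero] using ha.contDiff_δpow 0

lemma IsSmoothFun.δd (hα : IsIsomAction αa) {a : V → A} (ha : IsSmoothFun αa a) (j : Fin n) :
    IsSmoothFun αa fun x => δd αa j (a x) where
  mem x := δd_mem hα j (ha.mem x)
  contDiff_δpow c := by
    simpa only [δpow_δd hα c j (ha.mem _)] using ha.contDiff_δpow (c + Pi.single j 1)

lemma IsSmoothFun.hasDerivations (hα : IsIsomAction αa) {a : V → A} (ha : IsSmoothFun αa a) :
    HasDerivations αa a fun j x => _root_.δd αa j (a x) where
  contDiff := ha.contDiff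
  contDiff' j := (ha.δd hα j).contDiff
  hasOrbitDeriv x := hasOrbitDeriv_of_mem (ha.mem x)

lemma HasDerivations.δd_eq {a : V → A} {a' : Fin n → V → A} (h : HasDerivations αa a a')
    (j : Fin n) : (fun x => δd αa j (a x)) = a' j :=
  funext fun x => (h.hasOrbitDeriv x).δd_eq j

/-- Applying `δ^c` pointwise is iterating the pointwise application of the derivations. -/
lemma δpow_comp_eq (c : Fin n → ℕ) (a : V → A) :
    (fun x => δpow αa c (a x)) = powComp (fun j (b : V → A) x => δd αa j (b x)) c a := by
  ext x
  exact (powComp_semiconj_on (T := δd αa) (T' := fun j (b : V → A) x => δd αa j (b x))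
    (φ := fun b : V → A => b x) (S := Set.univ) (fun _ _ _ => trivial)
    (fun _ _ _ => rfl) c a trivial).1

/-- A set of smooth functions stable under the derivations consists of smooth maps into `𝒜_θ`. -/
lemma isSmoothFun_of_mem (hα : IsIsomAction αa) {S : Set (V → A)}
    (hS : ∀ a ∈ S, ∃ a' : Fin n → V → A, (∀ j, a' j ∈ S) ∧ HasDerivations αa a a') {a : V → A}
    (ha : a ∈ S) : IsSmoothFun αa a where
  mem x := by
    refine subset_smoothSet (S := {u | ∃ a ∈ S, ∃ x, a x = u}) hα ?_ ⟨a, ha, x, rfl⟩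
    rintro _ ⟨a, ha, x, rfl⟩
    obtain ⟨a', h', h⟩ := hS a ha
    exact ⟨fun j => a' j x, fun j => ⟨a' j, h' j, x, rfl⟩, h.hasOrbitDeriv x⟩
  contDiff_δpow c := by
    rw [δpow_comp_eq]
    have hmem : powComp (fun j (b : V → A) x => δd αa j (b x)) c a ∈ S := by
      refine powComp_mem (fun j b hb => ?_) c ha
      obtain ⟨b', h', h⟩ := hS b hb
      rw [h.δd_eq]
      exact h' j
    obtain ⟨_, _, h⟩ := hS _ hmem
    exact h.contDiff

namespace HasDerivations

variable {a b : V → A} {a' b' : Fin n → V → A}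

lemma add (ha : HasDerivations αa a a') (hb : HasDerivations αa b b') :
    HasDerivations αa (fun x => a x + b x) fun j x => a' j x + b' j x where
  contDiff := ha.contDiff.add hb.contDiff
  contDiff' j := (ha.contDiff' j).add (hb.contDiff' j)
  hasOrbitDeriv x := (ha.hasOrbitDeriv x).add (hb.hasOrbitDeriv x)

lemma sub (ha : HasDerivations αa a a') (hb : HasDerivations αa b b') :
    HasDerivations αa (fun x => a x - b x) fun j x => a' j x - b' j x where
  contDiff := ha.contDiff.sub hb.contDiff
  contDiff' j := (ha.contDiff' j).sub (hb.contDiff' j)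
  hasOrbitDeriv x := (ha.hasOrbitDeriv x).sub (hb.hasOrbitDeriv x)

lemma const_smul (c : ℂ) (ha : HasDerivations αa a a') :
    HasDerivations αa (fun x => c • a x) fun j x => c • a' j x where
  contDiff := ha.contDiff.const_smul c
  contDiff' j := (ha.contDiff' j).const_smul c
  hasOrbitDeriv x := (ha.hasOrbitDeriv x).const_smul c

lemma smul {r : V → ℝ} (hr : ContDiff ℝ ∞ r) (ha : HasDerivations αa a a') :
    HasDerivations αa (fun x => r x • a x) fun j x => r x • a' j x where
  contDiff := hr.smul ha.contDiff
  contDiff' j := hr.smul (ha.contDiff' j)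
  hasOrbitDeriv x := by
    simpa only [Complex.coe_smul] using (ha.hasOrbitDeriv x).const_smul (r x : ℂ)

lemma sum {ι : Type*} (s : Finset ι) {a : ι → V → A} {a' : ι → Fin n → V → A}
    (ha : ∀ i, HasDerivations αa (a i) (a' i)) :
    HasDerivations αa (fun x => ∑ i ∈ s, a i x) fun j x => ∑ i ∈ s, a' i j x := by
  classical
  induction s using Finset.induction_on with
  | empty =>
    simp only [Finset.sum_empty]
    refine ⟨contDiff_const, fun _ => contDiff_const, fun x => ?_⟩
    simp only [HasOrbitDeriv, map_zero, orbitDeriv, smul_zero]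
    convert hasFDerivAt_const (0 : A) (0 : Rn n)
    ext; simp
  | insert i s hi ih =>
    simp only [Finset.sum_insert hi]
    exact (ha i).add ih

lemma dirDeriv (hα : IsIsomAction αa) (v : V) (ha : HasDerivations αa a a') :
    HasDerivations αa (dirDeriv v a) fun j => _root_.dirDeriv v (a' j) where
  contDiff := ha.contDiff.dirDeriv v
  contDiff' j := (ha.contDiff' j).dirDeriv v
  hasOrbitDeriv x := by
    have := hasOrbitDeriv_dirDeriv hα v x (ha.contDiff.differentiable_of_infty x)
      (fun y => (ha.hasOrbitDeriv y).differentiableAt)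
      (fun j => by rw [ha.δd_eq]; exact (ha.contDiff' j).differentiable_of_infty x)
    simpa only [ha.δd_eq] using this

end HasDerivations

lemma IsSmoothFun.dirDeriv (hα : IsIsomAction αa) {a : V → A} (ha : IsSmoothFun αa a) (v : V) :
    IsSmoothFun αa (dirDeriv v a) := by
  refine isSmoothFun_of_mem (S := {b | ∃ a, IsSmoothFun αa a ∧ _root_.dirDeriv v a = b}) hα ?_
    ⟨a, ha, rfl⟩
  rintro _ ⟨a, ha, rfl⟩
  exact ⟨_, fun j => ⟨_, ha.δd hα j, rfl⟩, (ha.hasDerivations hα).dirDeriv hα v⟩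

lemma δpow_dirDeriv (hα : IsIsomAction αa) {a : V → A} (ha : IsSmoothFun αa a) (v : V)
    (c : Fin n → ℕ) :
    (fun x => δpow αa c (dirDeriv v a x)) = dirDeriv v fun x => δpow αa c (a x) := by
  rw [δpow_comp_eq, δpow_comp_eq]
  exact (powComp_semiconj_on (S := {a | IsSmoothFun αa a}) (φ := dirDeriv v)
    (fun j b hb => IsSmoothFun.δd hα hb j)
    (fun j b hb => ((hb.hasDerivations hα).dirDeriv hα v).δd_eq j) c a ha).1

lemma IsAmplitude.isSmoothFun {m : ℝ} {a : R2n n → A} (ha : IsAmplitude αa m a) :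
    IsSmoothFun αa a where
  mem := ha.1
  contDiff_δpow c := contDiff_infty.2 (ha.2.1 c)

end SmoothFun

/-! ### The transposed operator on smooth maps -/

section Ltrans

variable {αa : Rn n → (A ≃⋆ₐ[ℂ] A)} {χc : R2n n → ℝ}

lemma contDiff_fst_apply (j : Fin n) : ContDiff ℝ ∞ fun x : R2n n => x.1 j :=
  (EuclideanSpace.proj j : Rn n →L[ℝ] ℝ).contDiff.comp contDiff_fst

lemma contDiff_snd_apply (j : Fin n) : ContDiff ℝ ∞ fun x : R2n n => x.2 j :=
  (EuclideanSpace.proj j : Rn n →L[ℝ] ℝ).contDiff.comp contDiff_snd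

lemma HasDerivations.Ltrans (hα : IsIsomAction αa) (hχ : ContDiff ℝ ∞ χc)
    (hL : ContDiff ℝ ∞ (Lcoef χc)) {a : R2n n → A} {a' : Fin n → R2n n → A}
    (ha : HasDerivations αa a a') :
    HasDerivations αa (Ltrans χc a) fun j => Ltrans χc (a' j) :=
  (ha.smul hχ).sub <| HasDerivations.sum Finset.univ fun j =>
    (((ha.smul (hL.mul (contDiff_snd_apply j))).dirDeriv hα _).const_smul _).add
      (((ha.smul (hL.mul (contDiff_fst_apply j))).dirDeriv hα _).const_smul _)

lemma HasDerivations.iterate_Ltrans (hα : IsIsomAction αa) (hχ : ContDiff ℝ ∞ χc)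
    (hL : ContDiff ℝ ∞ (Lcoef χc)) {a : R2n n → A} {a' : Fin n → R2n n → A}
    (ha : HasDerivations αa a a') (N : ℕ) :
    HasDerivations αa ((_root_.Ltrans χc)^[N] a) fun j => (_root_.Ltrans χc)^[N] (a' j) := by
  induction N generalizing a a' with
  | zero => exact ha
  | succ N ih => exact ih (ha.Ltrans hα hχ hL)

end Ltrans

/-! ### Symbol-type estimates on `ℝⁿ × ℝⁿ` -/

section SymBound

variable {E : Type*} [NormedAddCommGroup E] [NormedSpace ℝ E]

/-- The weight `1 + |s| + |ξ|`. -/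
def weight (x : R2n n) : ℝ := 1 + ‖x.1‖ + ‖x.2‖

/-- The standard basis of `ℝⁿ × ℝⁿ`. -/
def basisVec (n : ℕ) : Fin n ⊕ Fin n → R2n n :=
  Sum.elim (fun j => (EuclideanSpace.single j 1, 0)) fun j => (0, EuclideanSpace.single j 1)

/-- All iterated partial derivatives of `f` of order `≤ K` are bounded by `C (1+|s|+|ξ|)^m`. -/
def SymBound (m : ℝ) : ℕ → ℝ → (R2n n → E) → Prop
  | 0, C, f => ∀ x, ‖f x‖ ≤ C * weight x ^ m
  | K + 1, C, f => (∀ x, ‖f x‖ ≤ C * weight x ^ m) ∧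
      ∀ i, SymBound m K C (dirDeriv (basisVec n i) f)

lemma one_le_weight (x : R2n n) : 1 ≤ weight x := by
  unfold weight; linarith [norm_nonneg x.1, norm_nonneg x.2]

lemma weight_pos (x : R2n n) : 0 < weight x := one_pos.trans_le (one_le_weight x)

lemma norm_le_weight (x : R2n n) : ‖x‖ ≤ weight x := by
  rw [Prod.norm_def, weight]
  exact max_le (by linarith [norm_nonneg x.2]) (by linarith [norm_nonneg x.1])

lemma continuous_weight : Continuous (weight : R2n n → ℝ) := by
  unfold weight; fun_prop

namespace SymBound

variable {m m₁ m₂ : ℝ} {K : ℕ} {C C₁ C₂ : ℝ} {f g : R2n n → E}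

lemma norm_le (h : SymBound m K C f) (x : R2n n) : ‖f x‖ ≤ C * weight x ^ m := by
  cases K with
  | zero => exact h x
  | succ K => exact h.1 x

lemma nonneg (h : SymBound m K C f) : 0 ≤ C := by
  have h1 := (norm_nonneg _).trans (h.norm_le 0)
  simpa [weight] using h1

lemma of_succ (h : SymBound m (K + 1) C f) : SymBound m K C f := by
  induction K generalizing f with
  | zero => exact h.1
  | succ K ih => exact ⟨h.1, fun i => ih (h.2 i)⟩

lemma mono_const (hC : C₁ ≤ C₂) (h : SymBound m K C₁ f) : SymBound m K C₂ f := by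
  have base : ∀ {f : R2n n → E}, (∀ x, ‖f x‖ ≤ C₁ * weight x ^ m) →
      ∀ x, ‖f x‖ ≤ C₂ * weight x ^ m := fun hf x =>
    (hf x).trans (by have := (weight_pos x).le; gcongr)
  induction K generalizing f with
  | zero => exact base h
  | succ K ih => exact ⟨base h.1, fun i => ih (h.2 i)⟩

lemma mono_order (hm : m₁ ≤ m₂) (h : SymBound m₁ K C f) : SymBound m₂ K C f := by
  have base : ∀ {f : R2n n → E}, (∀ x, ‖f x‖ ≤ C * weight x ^ m₁) →
      ∀ x, ‖f x‖ ≤ C * weight x ^ m₂ := fun hf x =>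
    (hf x).trans (by have := one_le_weight x; have := h.nonneg; gcongr)
  induction K generalizing f with
  | zero => exact base h
  | succ K ih => exact ⟨base h.1, fun i => ih (h.2 i)⟩

lemma add (hf : SymBound m K C₁ f) (hg : SymBound m K C₂ g) (hf' : ContDiff ℝ ∞ f)
    (hg' : ContDiff ℝ ∞ g) : SymBound m K (C₁ + C₂) fun x => f x + g x := by
  have base : ∀ {K : ℕ} {f g : R2n n → E}, SymBound m K C₁ f → SymBound m K C₂ g →
      ∀ x, ‖f x + g x‖ ≤ (C₁ + C₂) * weight x ^ m := fun hf hg x => by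
    rw [add_mul]
    exact (norm_add_le _ _).trans (add_le_add (hf.norm_le x) (hg.norm_le x))
  induction K generalizing f g with
  | zero => exact base hf hg
  | succ K ih =>
    refine ⟨base hf hg, fun i => ?_⟩
    rw [dirDeriv_add hf'.differentiable_of_infty hg'.differentiable_of_infty]
    exact ih (hf.2 i) (hg.2 i) (hf'.dirDeriv _) (hg'.dirDeriv _)

lemma zero : SymBound m K 0 fun _ : R2n n => (0 : E) := by
  induction K with
  | zero => intro x; simp
  | succ K ih =>
    refine ⟨fun x => by simp, fun i => ?_⟩
    have : dirDeriv (basisVec n i) (fun _ : R2n n => (0 : E)) = fun _ => 0 := by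
      ext x; simp [dirDeriv]
    rwa [this]

lemma sum {ι : Type*} (s : Finset ι) {f : ι → R2n n → E} {C : ι → ℝ}
    (hf : ∀ i, SymBound m K (C i) (f i)) (hf' : ∀ i, ContDiff ℝ ∞ (f i)) :
    SymBound m K (∑ i ∈ s, C i) fun x => ∑ i ∈ s, f i x := by
  classical
  induction s using Finset.induction_on with
  | empty => simpa using zero
  | insert i s hi ih =>
    simp only [Finset.sum_insert hi]
    exact (hf i).add ih (hf' i) (ContDiff.sum fun j _ => hf' j)

lemma const_smul {E : Type*} [NormedAddCommGroup E] [NormedSpace ℂ E] {f : R2n n → E} {c : ℂ}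
    (hc : ‖c‖ = 1) (hf : SymBound m K C f) (hf' : ContDiff ℝ ∞ f) :
    SymBound m K C fun x => c • f x := by
  induction K generalizing f with
  | zero => intro x; simpa [norm_smul, hc] using hf x
  | succ K ih =>
    refine ⟨fun x => by simpa [norm_smul, hc] using hf.1 x, fun i => ?_⟩
    rw [dirDeriv_const_smul _ hf'.differentiable_of_infty]
    exact ih (hf.2 i) (hf'.dirDeriv _)

lemma smul {m₃ : ℝ} (hm : m₁ + m₂ = m₃) {r : R2n n → ℝ} (hr : SymBound m₁ K C₁ r)
    (hf : SymBound m₂ K C₂ f) (hr' : ContDiff ℝ ∞ r) (hf' : ContDiff ℝ ∞ f) :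
    SymBound m₃ K (2 ^ K * C₁ * C₂) fun x => r x • f x := by
  have hC₁ := hr.nonneg
  have hC₂ := hf.nonneg
  have base : ∀ {K : ℕ} {r : R2n n → ℝ} {f : R2n n → E}, SymBound m₁ K C₁ r →
      SymBound m₂ K C₂ f → ∀ x, ‖r x • f x‖ ≤ 2 ^ K * C₁ * C₂ * weight x ^ m₃ := by
    intro K r f hr hf x
    rw [norm_smul, ← hm, Real.rpow_add (weight_pos x)]
    have := (weight_pos x).le
    have h1 : (1 : ℝ) ≤ 2 ^ K := one_le_pow₀ one_le_two
    calc ‖r x‖ * ‖f x‖ ≤ (C₁ * weight x ^ m₁) * (C₂ * weight x ^ m₂) := by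
          gcongr
          · exact hr.norm_le x
          · exact hf.norm_le x
      _ ≤ 2 ^ K * ((C₁ * weight x ^ m₁) * (C₂ * weight x ^ m₂)) :=
          le_mul_of_one_le_left (by positivity) h1
      _ = _ := by ring
  induction K generalizing r f with
  | zero => exact base hr hf
  | succ K ih =>
    refine ⟨base hr hf, fun i => ?_⟩
    rw [dirDeriv_smul hr'.differentiable_of_infty hf'.differentiable_of_infty,
      show (2 : ℝ) ^ (K + 1) * C₁ * C₂ = 2 ^ K * C₁ * C₂ + 2 ^ K * C₁ * C₂ by ring]
    exact (ih hr.of_succ (hf.2 i) hr' (hf'.dirDeriv _)).add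
      (ih (hr.2 i) hf.of_succ (hr'.dirDeriv _) hf') (hr'.smul (hf'.dirDeriv _))
      ((hr'.dirDeriv _).smul hf')

end SymBound

/-- Scalar symbols of order `m` on `ℝⁿ × ℝⁿ` (no gain under differentiation). -/
structure IsSym (m : ℝ) (r : R2n n → ℝ) : Prop where
  contDiff : ContDiff ℝ ∞ r
  bound : ∀ K, ∃ C, SymBound m K C r

namespace IsSym

variable {m m₁ m₂ : ℝ} {r r' : R2n n → ℝ}

lemma exists_symBound_succ {K : ℕ} {C : ℝ} (h0 : ∀ x, ‖r x‖ ≤ C * weight x ^ m)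
    (h1 : ∀ i, ∃ C, SymBound m K C (_root_.dirDeriv (basisVec n i) r)) :
    ∃ C, SymBound m (K + 1) C r := by
  choose D hD using h1
  have hD0 : ∀ i, 0 ≤ D i := fun i => (hD i).nonneg
  refine ⟨|C| + ∑ i, D i, fun x => (h0 x).trans ?_, fun i => (hD i).mono_const ?_⟩
  · have := (weight_pos x).le
    have : C ≤ |C| + ∑ i, D i := by
      linarith [le_abs_self C, Finset.sum_nonneg fun i (_ : i ∈ Finset.univ) => hD0 i]
    gcongr
  · linarith [abs_nonneg C, Finset.single_le_sum (f := D) (fun i _ => hD0 i) (Finset.mem_univ i)]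

lemma of_dirDeriv {C : ℝ} (hr : ContDiff ℝ ∞ r) (h0 : ∀ x, ‖r x‖ ≤ C * weight x ^ m)
    (h1 : ∀ i, IsSym m (_root_.dirDeriv (basisVec n i) r)) : IsSym m r where
  contDiff := hr
  bound K := by
    cases K with
    | zero => exact ⟨C, h0⟩
    | succ K => exact exists_symBound_succ h0 fun i => (h1 i).bound K

lemma add (h : IsSym m r) (h' : IsSym m r') : IsSym m fun x => r x + r' x where
  contDiff := h.contDiff.add h'.contDiff
  bound K := by
    obtain ⟨C, hC⟩ := h.bound K
    obtain ⟨C', hC'⟩ := h'.bound K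
    exact ⟨_, hC.add hC' h.contDiff h'.contDiff⟩

lemma mul {m₃ : ℝ} (hm : m₁ + m₂ = m₃) (h : IsSym m₁ r) (h' : IsSym m₂ r') :
    IsSym m₃ fun x => r x * r' x where
  contDiff := h.contDiff.mul h'.contDiff
  bound K := by
    obtain ⟨C, hC⟩ := h.bound K
    obtain ⟨C', hC'⟩ := h'.bound K
    exact ⟨_, hC.smul hm hC' h.contDiff h'.contDiff⟩

lemma mono (hm : m₁ ≤ m₂) (h : IsSym m₁ r) : IsSym m₂ r where
  contDiff := h.contDiff
  bound K := (h.bound K).imp fun _ hC => hC.mono_order hm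

lemma const (c : ℝ) : IsSym 0 fun _ : R2n n => c where
  contDiff := contDiff_const
  bound K := by
    cases K with
    | zero => exact ⟨‖c‖, fun x => by simp⟩
    | succ K =>
      refine exists_symBound_succ (C := ‖c‖) (fun x => by simp) fun i => ⟨0, ?_⟩
      have : _root_.dirDeriv (basisVec n i) (fun _ : R2n n => c) = fun _ => 0 := by
        ext x; simp [_root_.dirDeriv]
      rw [this]
      exact SymBound.zero

lemma clm (l : R2n n →L[ℝ] ℝ) : IsSym 1 l := by
  refine of_dirDeriv (C := ‖l‖) l.contDiff (fun x => ?_) fun i => ?_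
  · rw [Real.rpow_one]
    exact (l.le_opNorm x).trans (by gcongr; exact norm_le_weight x)
  · have : _root_.dirDeriv (basisVec n i) l = fun _ => l (basisVec n i) := by
      ext x; simp [_root_.dirDeriv]
    rw [this]
    exact (const _).mono zero_le_one

lemma of_hasCompactSupport (m : ℝ) (hr : ContDiff ℝ ∞ r) (hs : HasCompactSupport r) :
    IsSym m r where
  contDiff := hr
  bound K := by
    have base : ∀ {r : R2n n → ℝ}, ContDiff ℝ ∞ r → HasCompactSupport r →
        ∃ C, ∀ x, ‖r x‖ ≤ C * weight x ^ m := by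
      intro r hr hs
      have hc : Continuous fun x => weight x ^ (-m) * r x :=
        (continuous_weight.rpow_const fun x => Or.inl (weight_pos x).ne').mul hr.continuous
      obtain ⟨C, hC⟩ := hs.mul_left.exists_bound_of_continuous hc
      refine ⟨C, fun x => ?_⟩
      have h1 : ‖weight x ^ (-m) * r x‖ ≤ C := hC x
      have hw : 0 < weight x ^ m := Real.rpow_pos_of_pos (weight_pos x) _
      rw [norm_mul, Real.rpow_neg (weight_pos x).le, norm_inv, Real.norm_of_nonneg hw.le,
        inv_mul_le_iff₀ hw] at h1
      linarith
    induction K generalizing r with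
    | zero => exact base hr hs
    | succ K ih =>
      obtain ⟨C, hC⟩ := base hr hs
      refine exists_symBound_succ hC fun i => ih (hr.dirDeriv _) ?_
      exact (hs.fderiv (𝕜 := ℝ)).comp_left (g := fun l : R2n n →L[ℝ] ℝ => l (basisVec n i)) rfl

/-- Inverses of elliptic functions of order `2` are symbols of order `-2`. -/
lemma inv {q : R2n n → ℝ} {c : ℝ} (hc : 0 < c) (hq : ContDiff ℝ ∞ q)
    (hq' : ∀ i, IsSym 1 (_root_.dirDeriv (basisVec n i) q))
    (hell : ∀ x, c * weight x ^ (2 : ℝ) ≤ q x) : IsSym (-2) fun x => (q x)⁻¹ := by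
  have hpos : ∀ x, 0 < q x := fun x =>
    (mul_pos hc (Real.rpow_pos_of_pos (weight_pos x) _)).trans_le (hell x)
  have hinv : ContDiff ℝ ∞ fun x => (q x)⁻¹ := hq.inv fun x => (hpos x).ne'
  have h0 : ∀ x, ‖(q x)⁻¹‖ ≤ c⁻¹ * weight x ^ (-2 : ℝ) := fun x => by
    rw [Real.norm_of_nonneg (inv_nonneg.2 (hpos x).le), Real.rpow_neg (weight_pos x).le, ← mul_inv]
    exact inv_anti₀ (mul_pos hc (Real.rpow_pos_of_pos (weight_pos x) _)) (hell x)
  refine ⟨hinv, fun K => ?_⟩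
  induction K with
  | zero => exact ⟨_, h0⟩
  | succ K ih =>
    obtain ⟨C, hC⟩ := ih
    refine exists_symBound_succ h0 fun i => ?_
    obtain ⟨D, hD⟩ := ((IsSym.const (-1)).mul (zero_add 1) (hq' i)).bound K
    have hd : _root_.dirDeriv (basisVec n i) (fun x => (q x)⁻¹) =
        fun x => (-1 * _root_.dirDeriv (basisVec n i) q x) * ((q x)⁻¹ * (q x)⁻¹) := by
      ext x
      have := ((hasDerivAt_inv (hpos x).ne').comp_hasFDerivAt x
        (hq.differentiable_of_infty x).hasFDerivAt).fderiv
      simp only [_root_.dirDeriv]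
      rw [show (fun x => (q x)⁻¹) = (fun y => y⁻¹) ∘ q from rfl, this]
      simp only [smul_apply, smul_eq_mul]
      ring
    rw [hd]
    have hprod := hC.smul (show (-2 : ℝ) + -2 = -4 by norm_num) hC hinv hinv
    have := hD.smul (show (1 : ℝ) + -4 = -3 by norm_num) hprod
      (contDiff_const.mul (hq.dirDeriv _)) (hinv.mul hinv)
    exact ⟨_, this.mono_order (by norm_num)⟩

end IsSym

end SymBound

/-! ### The coefficients of `L` -/

section Coefficients

variable {χc : R2n n → ℝ}

/-- `|s|² + |ξ|²`. -/
def normSqSum (x : R2n n) : ℝ := ‖x.1‖ ^ 2 + ‖x.2‖ ^ 2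

lemma contDiff_normSqSum : ContDiff ℝ ∞ (normSqSum : R2n n → ℝ) :=
  (contDiff_fst.norm_sq ℝ).add (contDiff_snd.norm_sq ℝ)

lemma normSqSum_pos {x : R2n n} (hx : x ≠ 0) : 0 < normSqSum x := by
  unfold normSqSum
  rcases eq_or_ne x.1 0 with h | h
  · have h2 : x.2 ≠ 0 := fun h2 => hx (Prod.ext h h2)
    positivity
  · positivity

lemma sq_norm_le_normSqSum (x : R2n n) : ‖x‖ ^ 2 ≤ normSqSum x := by
  unfold normSqSum
  rw [Prod.norm_def]
  rcases max_choice ‖x.1‖ ‖x.2‖ with h | h <;> rw [h] <;> nlinarith [sq_nonneg ‖x.1‖, sq_nonneg ‖x.2‖]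

lemma isSym_dirDeriv_normSqSum (v : R2n n) : IsSym 1 (dirDeriv v normSqSum) := by
  convert IsSym.clm ((2 : ℝ) • ((innerSL ℝ v.1).comp (ContinuousLinearMap.fst ℝ (Rn n) (Rn n)) +
    (innerSL ℝ v.2).comp (ContinuousLinearMap.snd ℝ (Rn n) (Rn n)))) using 1
  ext x
  have h1 := (hasFDerivAt_fst (𝕜 := ℝ) (p := x)).norm_sq
  have h2 := (hasFDerivAt_snd (𝕜 := ℝ) (p := x)).norm_sq
  have := (h1.add h2).fderiv
  simp only [dirDeriv]
  rw [show (normSqSum : R2n n → ℝ) = (fun x : R2n n => ‖x.1‖ ^ 2) + fun x => ‖x.2‖ ^ 2 from rfl,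
    this]
  simp [real_inner_comm]

lemma exists_mul_weight_sq_le (hχ1 : ∀ᶠ x in 𝓝 (0 : R2n n), χc x = 1) :
    ∃ c > 0, ∀ x, c * weight x ^ (2 : ℝ) ≤ normSqSum x + χc x ^ 2 := by
  obtain ⟨r, hr, hball⟩ := Metric.eventually_nhds_iff_ball.1 hχ1
  refine ⟨r ^ 2 / (3 * (1 + r ^ 2)), by positivity, fun x => ?_⟩
  have hw : weight x ^ (2 : ℝ) ≤ 3 * (1 + normSqSum x) := by
    rw [Real.rpow_two, weight, normSqSum]
    nlinarith [sq_nonneg (‖x.1‖ - ‖x.2‖), sq_nonneg (‖x.1‖ - 1), sq_nonneg (‖x.2‖ - 1)]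
  have hq : 0 ≤ normSqSum x := by unfold normSqSum; positivity
  refine (mul_le_mul_of_nonneg_left hw (by positivity)).trans ?_
  rw [div_mul_eq_mul_div, div_le_iff₀ (by positivity)]
  by_cases hx : ‖x‖ < r
  · rw [hball x (by simpa using hx)]
    nlinarith [sq_nonneg r, mul_nonneg (sq_nonneg r) hq]
  · have : r ^ 2 ≤ normSqSum x :=
      (pow_le_pow_left₀ hr.le (not_lt.1 hx) 2).trans (sq_norm_le_normSqSum x)
    nlinarith [sq_nonneg r, mul_nonneg (sq_nonneg r) (sq_nonneg (χc x)), sq_nonneg (χc x)]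

lemma contDiff_Lcoef (hχ : ContDiff ℝ ∞ χc) (hχ1 : ∀ᶠ x in 𝓝 (0 : R2n n), χc x = 1) :
    ContDiff ℝ ∞ (Lcoef χc) := by
  refine contDiff_iff_contDiffAt.2 fun x => ?_
  rcases eq_or_ne x 0 with rfl | hx
  · refine (contDiffAt_const (c := (0 : ℝ))).congr_of_eventuallyEq ?_
    filter_upwards [hχ1] with y hy
    simp [Lcoef, hy]
  · exact (contDiff_const.sub hχ).contDiffAt.div contDiff_normSqSum.contDiffAt
      (normSqSum_pos hx).ne'

lemma Lcoef_mul_normSqSum (hχ1 : ∀ᶠ x in 𝓝 (0 : R2n n), χc x = 1) (x : R2n n) :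
    Lcoef χc x * normSqSum x = 1 - χc x := by
  rcases eq_or_ne x 0 with rfl | hx
  · simp [Lcoef, normSqSum, hχ1.self_of_nhds]
  · exact div_mul_cancel₀ _ (normSqSum_pos hx).ne'

lemma isSym_Lcoef (hχ : ContDiff ℝ ∞ χc) (hχs : HasCompactSupport χc)
    (hχ1 : ∀ᶠ x in 𝓝 (0 : R2n n), χc x = 1) : IsSym (-2) (Lcoef χc) := by
  obtain ⟨c, hc, hell⟩ := exists_mul_weight_sq_le hχ1
  have hs2 : HasCompactSupport fun x => χc x ^ 2 := hχs.comp_left (g := fun t : ℝ => t ^ 2) (by simp)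
  have hinv : IsSym (-2) fun x => (normSqSum x + χc x ^ 2)⁻¹ := by
    refine IsSym.inv hc (contDiff_normSqSum.add (hχ.pow 2)) (fun i => ?_) hell
    rw [dirDeriv_add contDiff_normSqSum.differentiable_of_infty (hχ.pow 2).differentiable_of_infty]
    refine (isSym_dirDeriv_normSqSum _).add (IsSym.of_hasCompactSupport _
      ((hχ.pow 2).dirDeriv _) ?_)
    exact (hs2.fderiv (𝕜 := ℝ)).comp_left (g := fun l : R2n n →L[ℝ] ℝ => l (basisVec n i)) rfl
  have hL := contDiff_Lcoef hχ hχ1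
  have hnum : IsSym 0 fun x => 1 + (-χc x + Lcoef χc x * χc x ^ 2) := by
    refine (IsSym.const 1).add (IsSym.of_hasCompactSupport 0 (hχ.neg.add (hL.mul (hχ.pow 2))) ?_)
    exact hχs.neg.add hs2.mul_left
  convert hnum.mul (show (0 : ℝ) + -2 = -2 by norm_num) hinv using 1
  ext x
  have hpos : 0 < normSqSum x + χc x ^ 2 :=
    (mul_pos hc (Real.rpow_pos_of_pos (weight_pos x) _)).trans_le (hell x)
  rw [eq_mul_inv_iff_mul_eq₀ hpos.ne', mul_add, Lcoef_mul_normSqSum hχ1]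
  ring

lemma isSym_fst_apply (j : Fin n) : IsSym 1 fun x : R2n n => x.1 j :=
  IsSym.clm ((EuclideanSpace.proj j : Rn n →L[ℝ] ℝ).comp (ContinuousLinearMap.fst ℝ _ _))

lemma isSym_snd_apply (j : Fin n) : IsSym 1 fun x : R2n n => x.2 j :=
  IsSym.clm ((EuclideanSpace.proj j : Rn n →L[ℝ] ℝ).comp (ContinuousLinearMap.snd ℝ _ _))

lemma contDiff_Ltrans (hχ : ContDiff ℝ ∞ χc) (hL : ContDiff ℝ ∞ (Lcoef χc)) {f : R2n n → A}
    (hf : ContDiff ℝ ∞ f) : ContDiff ℝ ∞ (Ltrans χc f) :=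
  (hχ.smul hf).sub <| ContDiff.sum fun j _ =>
    ((((hL.mul (contDiff_snd_apply j)).smul hf).dirDeriv _).const_smul (-Complex.I)).add
      ((((hL.mul (contDiff_fst_apply j)).smul hf).dirDeriv _).const_smul (-Complex.I))

lemma contDiff_iterate_Ltrans (hχ : ContDiff ℝ ∞ χc) (hL : ContDiff ℝ ∞ (Lcoef χc))
    {f : R2n n → A} (hf : ContDiff ℝ ∞ f) (N : ℕ) : ContDiff ℝ ∞ ((Ltrans χc)^[N] f) := by
  induction N generalizing f with
  | zero => exact hf
  | succ N ih => exact ih (contDiff_Ltrans hχ hL hf)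

lemma exists_symBound_Ltrans (hχ : ContDiff ℝ ∞ χc) (hχs : HasCompactSupport χc)
    (hχ1 : ∀ᶠ x in 𝓝 (0 : R2n n), χc x = 1) (m : ℝ) (K : ℕ) :
    ∃ C', 0 ≤ C' ∧ ∀ (C : ℝ) (f : R2n n → A), ContDiff ℝ ∞ f → SymBound m (K + 1) C f →
      SymBound (m - 1) K (C' * C) (Ltrans χc f) := by
  have hL := isSym_Lcoef hχ hχs hχ1
  have hg := fun j => hL.mul (show (-2 : ℝ) + 1 = -1 by norm_num) (isSym_snd_apply j)
  have hg' := fun j => hL.mul (show (-2 : ℝ) + 1 = -1 by norm_num) (isSym_fst_apply j)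
  have hχsym := IsSym.of_hasCompactSupport (-1) hχ hχs
  obtain ⟨C₀, hC₀⟩ := hχsym.bound K
  choose D hD using fun j => (hg j).bound (K + 1)
  choose D' hD' using fun j => (hg' j).bound (K + 1)
  have hm : (-1 : ℝ) + m = m - 1 := by ring
  have hD0 := fun j => (hD j).nonneg
  have hD0' := fun j => (hD' j).nonneg
  have hC0 := hC₀.nonneg
  refine ⟨2 ^ K * C₀ + ∑ j, (2 ^ (K + 1) * D j + 2 ^ (K + 1) * D' j), ?_, fun C f hf hfC => ?_⟩
  · exact add_nonneg (by positivity)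
      (Finset.sum_nonneg fun j _ => by have := hD0 j; have := hD0' j; positivity)
  have e1 := fun j => (hD j).smul hm hfC (hg j).contDiff hf
  have e2 := fun j => (hD' j).smul hm hfC (hg' j).contDiff hf
  have c1 := fun j => ((hg j).contDiff.smul hf)
  have c2 := fun j => ((hg' j).contDiff.smul hf)
  have hI : ‖-Complex.I‖ = 1 := by simp
  have d1 := fun j => ((e1 j).2 (Sum.inl j)).const_smul hI ((c1 j).dirDeriv _)
  have d2 := fun j => ((e2 j).2 (Sum.inr j)).const_smul hI ((c2 j).dirDeriv _)
  have k1 := fun j => ((c1 j).dirDeriv (basisVec n (Sum.inl j))).const_smul (-Complex.I)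
  have k2 := fun j => ((c2 j).dirDeriv (basisVec n (Sum.inr j))).const_smul (-Complex.I)
  have hsum := SymBound.sum Finset.univ (fun j => (d1 j).add (d2 j) (k1 j) (k2 j))
    (fun j => (k1 j).add (k2 j))
  have hneg := hsum.const_smul (c := -1) (by simp)
    (ContDiff.sum fun j _ => (k1 j).add (k2 j))
  have key := (hC₀.smul hm hfC.of_succ hχ hf).add hneg (hχ.smul hf)
    (contDiff_const.smul (ContDiff.sum fun j _ => (k1 j).add (k2 j)))
  convert key using 1
  · rw [add_mul, Finset.sum_mul]
    simp only [add_mul]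
  · ext x
    rw [neg_one_smul, ← sub_eq_add_neg]
    rfl

lemma exists_symBound_iterate_Ltrans (hχ : ContDiff ℝ ∞ χc) (hχs : HasCompactSupport χc)
    (hχ1 : ∀ᶠ x in 𝓝 (0 : R2n n), χc x = 1) (m : ℝ) (N K : ℕ) :
    ∃ C', 0 ≤ C' ∧ ∀ (C : ℝ) (f : R2n n → A), ContDiff ℝ ∞ f → SymBound m (K + N) C f →
      SymBound (m - N) K (C' * C) ((Ltrans χc)^[N] f) := by
  induction N generalizing m with
  | zero => exact ⟨1, zero_le_one, fun C f _ h => by simpa using h⟩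
  | succ N ih =>
    obtain ⟨C₁, h₁, H₁⟩ := exists_symBound_Ltrans (A := A) hχ hχs hχ1 m (K + N)
    obtain ⟨C₂, h₂, H₂⟩ := ih (m - 1)
    refine ⟨C₂ * C₁, by positivity, fun C f hf hC => ?_⟩
    have := H₂ _ _ (contDiff_Ltrans hχ (contDiff_Lcoef hχ hχ1) hf) (H₁ C f hf hC)
    rw [mul_assoc]
    convert this using 1
    · push_cast; ring
    · rfl

end Coefficients

/-! ### Amplitude seminorms -/

section Seminorms

variable {αa : Rn n → (A ≃⋆ₐ[ℂ] A)} {m : ℝ} {a : R2n n → A}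

lemma apply_le_mdeg (b : Fin n → ℕ) (j : Fin n) : b j ≤ mdeg b :=
  Finset.single_le_sum (f := b) (fun _ _ => Nat.zero_le _) (Finset.mem_univ j)

lemma finite_mdeg_le (N : ℕ) : Finite {t : (Fin n → ℕ) × (Fin n → ℕ) × (Fin n → ℕ) //
    mdeg t.1 + mdeg t.2.1 + mdeg t.2.2 ≤ N} := by
  classical
  refine Set.Finite.subset (Set.finite_Icc
    (0 : (Fin n → ℕ) × (Fin n → ℕ) × (Fin n → ℕ)) (fun _ => N, fun _ => N, fun _ => N)) ?_
  rintro ⟨c, b, g⟩ (h : mdeg c + mdeg b + mdeg g ≤ N)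
  refine ⟨zero_le, fun j => ?_, fun j => ?_, fun j => ?_⟩
  · have := apply_le_mdeg c j; simp only; omega
  · have := apply_le_mdeg b j; simp only; omega
  · have := apply_le_mdeg g j; simp only; omega

lemma qSemi_nonneg (αa : Rn n → (A ≃⋆ₐ[ℂ] A)) (m : ℝ) (N : ℕ) (a : R2n n → A) :
    0 ≤ qSemi αa m N a :=
  Real.iSup_nonneg fun q =>
    mul_nonneg (Real.rpow_nonneg (weight_pos q.2).le _) (norm_nonneg _)

lemma IsAmplitude.bddAbove (ha : IsAmplitude αa m a) (N : ℕ) :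
    BddAbove (Set.range fun q : {t : (Fin n → ℕ) × (Fin n → ℕ) × (Fin n → ℕ) //
      mdeg t.1 + mdeg t.2.1 + mdeg t.2.2 ≤ N} × R2n n =>
    (1 + ‖q.2.1‖ + ‖q.2.2‖) ^ (-m) *
      ‖δpow αa q.1.1.1 (pdSPow q.1.1.2.1 (pdXiPow q.1.1.2.2 a) q.2)‖) := by
  have := finite_mdeg_le (n := n) N
  choose C hC hbound using ha.2.2
  obtain ⟨M, hM⟩ := (Set.finite_range fun t : {t : (Fin n → ℕ) × (Fin n → ℕ) × (Fin n → ℕ) //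
    mdeg t.1 + mdeg t.2.1 + mdeg t.2.2 ≤ N} => C t.1.1 t.1.2.1 t.1.2.2).bddAbove
  refine ⟨M, ?_⟩
  rintro _ ⟨⟨t, x⟩, rfl⟩
  refine le_trans ?_ (hM ⟨t, rfl⟩)
  have hw : 0 < weight x ^ m := Real.rpow_pos_of_pos (weight_pos x) _
  have h : _ ≤ C t.1.1 t.1.2.1 t.1.2.2 * weight x ^ m := hbound t.1.1 t.1.2.1 t.1.2.2 x
  change weight x ^ (-m) * _ ≤ _
  rw [Real.rpow_neg (weight_pos x).le, inv_mul_le_iff₀ hw]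
  linarith

lemma IsAmplitude.norm_le_qSemi (ha : IsAmplitude αa m a) {N : ℕ} {c b g : Fin n → ℕ}
    (h : mdeg c + mdeg b + mdeg g ≤ N) (x : R2n n) :
    ‖δpow αa c (pdSPow b (pdXiPow g a) x)‖ ≤ qSemi αa m N a * weight x ^ m := by
  have h1 := le_ciSup (ha.bddAbove N) (⟨(c, b, g), h⟩, x)
  have hw : 0 < weight x ^ m := Real.rpow_pos_of_pos (weight_pos x) _
  change weight x ^ (-m) * _ ≤ qSemi αa m N a at h1
  rw [Real.rpow_neg (weight_pos x).le, inv_mul_le_iff₀ hw] at h1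
  linarith

lemma IsSmoothFun.pdS_mem (hα : IsIsomAction αa) (j : Fin n) :
    ∀ b ∈ {b : R2n n → A | IsSmoothFun αa b}, pdS j b ∈ {b : R2n n → A | IsSmoothFun αa b} :=
  fun _ hb => hb.dirDeriv hα _

lemma IsSmoothFun.pdXi_mem (hα : IsIsomAction αa) (j : Fin n) :
    ∀ b ∈ {b : R2n n → A | IsSmoothFun αa b}, pdXi j b ∈ {b : R2n n → A | IsSmoothFun αa b} :=
  fun _ hb => hb.dirDeriv hα _

lemma dirDeriv_inl_pdSPow (hα : IsIsomAction αa) (ha : IsSmoothFun αa a) (b : Fin n → ℕ)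
    (i : Fin n) :
    dirDeriv (basisVec n (Sum.inl i)) (pdSPow b a) = pdSPow (b + Pi.single i 1) a :=
  apply_powComp_eq (IsSmoothFun.pdS_mem hα) (fun _ _ _ hy => dirDeriv_comm hy.contDiff _ _) b i ha

lemma dirDeriv_inr_pdSPow (hα : IsIsomAction αa) (ha : IsSmoothFun αa a) (b g : Fin n → ℕ)
    (i : Fin n) :
    dirDeriv (basisVec n (Sum.inr i)) (pdSPow b (pdXiPow g a)) =
      pdSPow b (pdXiPow (g + Pi.single i 1) a) := by
  have h1 := (powComp_semiconj_on (T := pdS) (T' := pdS) (φ := pdXi i)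
    (IsSmoothFun.pdS_mem hα) (fun _ _ hy => dirDeriv_comm hy.contDiff _ _) b (pdXiPow g a)
    (powComp_mem (IsSmoothFun.pdXi_mem hα) g ha)).1
  have h2 : pdXi i (pdXiPow g a) = pdXiPow (g + Pi.single i 1) a :=
    apply_powComp_eq (IsSmoothFun.pdXi_mem hα) (fun _ _ _ hy => dirDeriv_comm hy.contDiff _ _)
      g i ha
  rw [← h2]
  exact h1.symm

lemma IsAmplitude.symBound (hα : IsIsomAction αa) (ha : IsAmplitude αa m a) {N : ℕ} (K : ℕ)
    (c b g : Fin n → ℕ) (h : mdeg c + mdeg b + mdeg g + K ≤ N) :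
    SymBound m K (qSemi αa m N a) fun x => δpow αa c (pdSPow b (pdXiPow g a) x) := by
  induction K generalizing b g with
  | zero => exact ha.norm_le_qSemi h
  | succ K ih =>
    have hg : IsSmoothFun αa (pdXiPow g a) :=
      powComp_mem (IsSmoothFun.pdXi_mem hα) g ha.isSmoothFun
    have hb : IsSmoothFun αa (pdSPow b (pdXiPow g a)) := powComp_mem (IsSmoothFun.pdS_mem hα) b hg
    refine ⟨ha.norm_le_qSemi (by omega), fun i => ?_⟩
    rw [← δpow_dirDeriv hα hb]
    rcases i with i | i
    · rw [dirDeriv_inl_pdSPow hα hg]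
      exact ih _ _ (by rw [mdeg_add_single]; omega)
    · rw [dirDeriv_inr_pdSPow hα ha.isSmoothFun]
      exact ih _ _ (by rw [mdeg_add_single]; omega)

lemma IsAmplitude.symBound_δpow (hα : IsIsomAction αa) (ha : IsAmplitude αa m a) (K : ℕ)
    (c : Fin n → ℕ) : SymBound m K (qSemi αa m (mdeg c + K) a) fun x => δpow αa c (a x) := by
  have h0 : mdeg (0 : Fin n → ℕ) = 0 := by simp [mdeg]
  have := ha.symBound hα (N := mdeg c + K) K c 0 0 (by simp [h0])
  rwa [show pdXiPow 0 a = a from congrFun (powComp_zero_right _) a,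
    show pdSPow 0 a = a from congrFun (powComp_zero_right _) a] at this

end Seminorms

/-! ### Oscillating integrals -/

section Oscillation

open MeasureTheory

variable {χc : R2n n → ℝ}

/-- The oscillating factor `e^{is·ξ}`. -/
def osc (x : R2n n) : ℂ := Complex.exp (Complex.I * ((∑ j, x.1 j * x.2 j : ℝ) : ℂ))

lemma norm_osc (x : R2n n) : ‖osc x‖ = 1 := by
  rw [osc, mul_comm, Complex.norm_exp_ofReal_mul_I]

lemma hasFDerivAt_osc (x : R2n n) :
    HasFDerivAt osc (∑ j, ((Complex.I * osc x * (x.1 j : ℂ)) • Complex.ofRealCLM.comp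
      ((EuclideanSpace.proj j : Rn n →L[ℝ] ℝ).comp (ContinuousLinearMap.snd ℝ _ _)) +
      (Complex.I * osc x * (x.2 j : ℂ)) • Complex.ofRealCLM.comp
      ((EuclideanSpace.proj j : Rn n →L[ℝ] ℝ).comp (ContinuousLinearMap.fst ℝ _ _)))) x := by
  have h1 := fun j => (((EuclideanSpace.proj j : Rn n →L[ℝ] ℝ).comp
    (ContinuousLinearMap.fst ℝ (Rn n) (Rn n))).hasFDerivAt (x := x))
  have h2 := fun j => (((EuclideanSpace.proj j : Rn n →L[ℝ] ℝ).comp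
    (ContinuousLinearMap.snd ℝ (Rn n) (Rn n))).hasFDerivAt (x := x))
  have h3 := HasFDerivAt.fun_sum fun j (_ : j ∈ Finset.univ) => (h1 j).mul (h2 j)
  have h4 := ((Complex.ofRealCLM.hasFDerivAt.comp x h3).const_mul Complex.I).cexp
  refine h4.congr_fderiv ?_
  ext v <;>
  · simp [osc, Finset.mul_sum, mul_assoc]
    exact Finset.sum_congr rfl fun j _ => by ring

lemma contDiff_osc : ContDiff ℝ ∞ (osc : R2n n → ℂ) := by
  have h : ContDiff ℝ ∞ fun x : R2n n => ∑ j, x.1 j * x.2 j :=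
    ContDiff.sum fun j _ => (contDiff_fst_apply j).mul (contDiff_snd_apply j)
  exact (contDiff_const.mul (Complex.ofRealCLM.contDiff.comp h)).cexp

lemma fderiv_osc_inl (x : R2n n) (j : Fin n) :
    fderiv ℝ osc x (EuclideanSpace.single j 1, 0) = Complex.I * x.2 j * osc x := by
  rw [(hasFDerivAt_osc x).fderiv]
  simp [apply_ite Complex.ofReal]
  ring

lemma fderiv_osc_inr (x : R2n n) (j : Fin n) :
    fderiv ℝ osc x (0, EuclideanSpace.single j 1) = Complex.I * x.1 j * osc x := by
  rw [(hasFDerivAt_osc x).fderiv]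
  simp [apply_ite Complex.ofReal]
  ring

instance isAddHaarMeasure_volume_R2n : (volume : Measure (R2n n)).IsAddHaarMeasure :=
  Measure.prod.instIsAddHaarMeasure _ _

lemma integrable_weight_rpow {μ : ℝ} (hμ : μ < -(2 * n)) :
    Integrable (fun x : R2n n => weight x ^ μ) volume := by
  have h : (Module.finrank ℝ (R2n n) : ℝ) < -μ := by
    simp
    linarith
  have h0 : μ ≤ 0 := by
    have : (0 : ℝ) ≤ 2 * n := by positivity
    linarith
  refine (integrable_one_add_norm (μ := volume) h).mono'
    (continuous_weight.rpow_const fun x => Or.inl (weight_pos x).ne').aestronglyMeasurable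
    (Filter.Eventually.of_forall fun x => ?_)
  rw [Real.norm_of_nonneg (Real.rpow_nonneg (weight_pos x).le _), neg_neg]
  refine Real.rpow_le_rpow_of_nonpos (by positivity) ?_ h0
  rw [weight, Prod.norm_def]
  rcases max_choice ‖x.1‖ ‖x.2‖ with h | h <;> rw [h] <;>
    linarith [norm_nonneg x.1, norm_nonneg x.2]

lemma SymBound.integrable_osc_smul {μ C : ℝ} {K : ℕ} {g : R2n n → A} (hμ : μ < -(2 * n))
    (hg : Continuous g) (hC : SymBound μ K C g) : Integrable (fun x => osc x • g x) volume := by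
  refine ((integrable_weight_rpow hμ).const_mul C).mono'
    (contDiff_osc.continuous.smul hg).aestronglyMeasurable
    (Filter.Eventually.of_forall fun x => ?_)
  rw [norm_smul, norm_osc, one_mul]
  exact hC.norm_le x

/-- Integration by parts against the oscillating factor. -/
lemma integral_osc_smul_dirDeriv {μ C : ℝ} {h : R2n n → A} (hμ : μ < -(2 * n))
    (hh : ContDiff ℝ ∞ h) (hC : SymBound μ 1 C h) (i : Fin n ⊕ Fin n)
    (hint : Integrable (fun x => fderiv ℝ osc x (basisVec n i) • h x) volume) :
    Integrable (fun x => osc x • dirDeriv (basisVec n i) h x) volume ∧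
    ∫ x, osc x • dirDeriv (basisVec n i) h x = -∫ x, fderiv ℝ osc x (basisVec n i) • h x := by
  have h1 := SymBound.integrable_osc_smul hμ (hh.dirDeriv (basisVec n i)).continuous (hC.2 i)
  exact ⟨h1, integral_smul_fderiv_eq_neg_fderiv_smul_of_integrable hint h1
    (hC.integrable_osc_smul hμ hh.continuous)
    (fun x _ => contDiff_osc.differentiable_of_infty x)
    (fun x _ => hh.differentiable_of_infty x)⟩

lemma integral_osc_smul_Ltrans (hχ : ContDiff ℝ ∞ χc) (hχs : HasCompactSupport χc)
    (hχ1 : ∀ᶠ x in 𝓝 (0 : R2n n), χc x = 1) {μ C : ℝ} {g : R2n n → A} (hμ : μ < -(2 * n))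
    (hg : ContDiff ℝ ∞ g) (hC : SymBound μ 1 C g) :
    ∫ x, osc x • Ltrans χc g x = ∫ x, osc x • g x := by
  have hL := isSym_Lcoef hχ hχs hχ1
  have hs := fun j => hL.mul (show (-2 : ℝ) + 1 = -1 by norm_num) (isSym_snd_apply j)
  have hx := fun j => hL.mul (show (-2 : ℝ) + 1 = -1 by norm_num) (isSym_fst_apply j)
  have hs2 := fun j => (hs j).mul (show (-1 : ℝ) + 1 = 0 by norm_num) (isSym_snd_apply j)
  have hx2 := fun j => (hx j).mul (show (-1 : ℝ) + 1 = 0 by norm_num) (isSym_fst_apply j)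
  -- products of a symbol of order `≤ 0` with `g` are integrable
  have key : ∀ {r : R2n n → ℝ} {k : ℝ}, IsSym k r → k ≤ 0 →
      ContDiff ℝ ∞ (fun x => r x • g x) ∧ ∃ D, SymBound μ 1 D fun x => r x • g x := by
    intro r k hr hk
    obtain ⟨D, hD⟩ := (hr.mono hk).bound 1
    exact ⟨hr.contDiff.smul hg, _, hD.smul (zero_add μ) hC hr.contDiff hg⟩
  have hint : ∀ {r : R2n n → ℝ} {k : ℝ}, IsSym k r → k ≤ 0 →
      Integrable (fun x => osc x • r x • g x) volume := by
    intro r k hr hk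
    obtain ⟨h1, D, hD⟩ := key hr hk
    exact hD.integrable_osc_smul hμ h1.continuous
  have ibp : ∀ {r : R2n n → ℝ} {k : ℝ} (_ : IsSym k r) (_ : k ≤ 0) (i : Fin n ⊕ Fin n)
      {l : R2n n → ℝ} (_ : ∀ x, fderiv ℝ osc x (basisVec n i) = Complex.I * l x * osc x)
      (_ : IsSym 0 fun x => r x * l x),
      Integrable (fun x => osc x • (-Complex.I) • dirDeriv (basisVec n i) (fun y => r y • g y) x)
        volume ∧
      ∫ x, osc x • (-Complex.I) • dirDeriv (basisVec n i) (fun y => r y • g y) x =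
        -∫ x, osc x • (r x * l x) • g x := by
    intro r k hr hk i l hl hrl
    obtain ⟨h1, D, hD⟩ := key hr hk
    have e1 : (fun x => fderiv ℝ osc x (basisVec n i) • r x • g x) =
        fun x => Complex.I • osc x • (r x * l x) • g x := by
      ext x
      rw [hl, ← Complex.coe_smul, ← Complex.coe_smul, smul_smul, smul_smul, smul_smul]
      congr 1
      push_cast
      ring
    have e2 : (fun x => osc x • (-Complex.I) • dirDeriv (basisVec n i) (fun y => r y • g y) x) =
        fun x => (-Complex.I) • osc x • dirDeriv (basisVec n i) (fun y => r y • g y) x := by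
      ext x
      rw [smul_comm]
    obtain ⟨h3, h4⟩ := integral_osc_smul_dirDeriv hμ h1 hD i
      (by rw [e1]; exact (hint hrl le_rfl).smul Complex.I)
    rw [e2, integral_smul, h4, e1, integral_smul]
    refine ⟨h3.smul (-Complex.I), ?_⟩
    rw [smul_neg, smul_smul]
    simp
  have ps := fun j => ibp (hs j) (by norm_num) (Sum.inl j) (fun x => fderiv_osc_inl x j) (hs2 j)
  have px := fun j => ibp (hx j) (by norm_num) (Sum.inr j) (fun x => fderiv_osc_inr x j) (hx2 j)
  have hχint := hint (IsSym.of_hasCompactSupport 0 hχ hχs) le_rfl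
  have e : (fun x => osc x • Ltrans χc g x) = fun x => osc x • χc x • g x - ∑ j,
      (osc x • (-Complex.I) •
          dirDeriv (basisVec n (Sum.inl j)) (fun y => (Lcoef χc y * y.2 j) • g y) x +
        osc x • (-Complex.I) •
          dirDeriv (basisVec n (Sum.inr j)) (fun y => (Lcoef χc y * y.1 j) • g y) x) := by
    ext x
    simp only [← smul_add (osc x), ← Finset.smul_sum, ← smul_sub (osc x)]
    rfl
  have e' : (fun x => osc x • g x) = fun x => osc x • χc x • g x + ∑ j,
      (osc x • (Lcoef χc x * x.2 j * x.2 j) • g x +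
        osc x • (Lcoef χc x * x.1 j * x.1 j) • g x) := by
    ext x
    simp only [← smul_add, ← Finset.smul_sum, ← add_smul, ← Finset.sum_smul]
    have hq : ∑ j, (Lcoef χc x * x.2 j * x.2 j + Lcoef χc x * x.1 j * x.1 j) = 1 - χc x := by
      rw [← Lcoef_mul_normSqSum hχ1, normSqSum, EuclideanSpace.norm_sq_eq,
        EuclideanSpace.norm_sq_eq, ← Finset.sum_add_distrib, Finset.mul_sum]
      refine Finset.sum_congr rfl fun j _ => ?_
      rw [Real.norm_eq_abs, Real.norm_eq_abs, sq_abs, sq_abs]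
      ring
    rw [hq, add_sub_cancel, one_smul]
  rw [e, e', integral_sub hχint (integrable_finsetSum _ fun j _ => (ps j).1.fun_add (px j).1),
    integral_add hχint (integrable_finsetSum _ fun j _ =>
      (hint (hs2 j) le_rfl).fun_add (hint (hx2 j) le_rfl)),
    integral_finsetSum _ fun j _ => (ps j).1.fun_add (px j).1,
    integral_finsetSum _ fun j _ => (hint (hs2 j) le_rfl).fun_add (hint (hx2 j) le_rfl),
    sub_eq_add_neg, ← Finset.sum_neg_distrib]
  congr 1
  refine Finset.sum_congr rfl fun j _ => ?_
  rw [integral_add (ps j).1 (px j).1, integral_add (hint (hs2 j) le_rfl) (hint (hx2 j) le_rfl),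
    (ps j).2, (px j).2]
  abel

end Oscillation

/-! ### Derivations of oscillating integrals -/

section Josc

open MeasureTheory

variable {αa : Rn n → (A ≃⋆ₐ[ℂ] A)} {χc : R2n n → ℝ} {m : ℝ} {a : R2n n → A} {N : ℕ}

lemma integrable_orbitDeriv {X : Type*} [MeasurableSpace X] {ν : Measure X} {G' : Fin n → X → A}
    (hG' : ∀ j, Integrable (G' j) ν) : Integrable (fun x => orbitDeriv fun j => G' j x) ν := by
  let φ (j : Fin n) : Rn n →L[ℝ] ℝ := EuclideanSpace.proj j
  have h (j : Fin n) : Integrable (fun x => (φ j).smulRight (Complex.I • G' j x)) ν :=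
    (ContinuousLinearMap.smulRightL ℝ (Rn n) A (φ j)).integrable_comp
      (φ := fun x => Complex.I • G' j x) ((hG' j).smul Complex.I)
  have h' := integrable_finsetSum (f := fun j x => (φ j).smulRight (Complex.I • G' j x))
    Finset.univ fun j _ => h j
  exact h'

lemma integral_orbitDeriv {X : Type*} [MeasurableSpace X] {ν : Measure X} {G' : Fin n → X → A}
    (hG' : ∀ j, Integrable (G' j) ν) :
    ∫ x, (orbitDeriv fun j => G' j x) ∂ν = orbitDeriv fun j => ∫ x, G' j x ∂ν := by
  ext v
  rw [ContinuousLinearMap.integral_apply (integrable_orbitDeriv hG'), orbitDeriv_apply]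
  simp only [orbitDeriv_apply]
  have h (j : Fin n) : Integrable (fun x => v j • Complex.I • G' j x) ν :=
    ((hG' j).smul Complex.I).smul (v j)
  rw [integral_finsetSum _ fun j _ => h j]
  refine Finset.sum_congr rfl fun j _ => ?_
  rw [integral_smul, integral_smul]

/-- Derivations of an integral are computed under the integral sign. -/
lemma hasOrbitDeriv_integral (hα : IsIsomAction αa) {X : Type*} [MeasurableSpace X]
    {ν : Measure X} {G : X → A} {G' : Fin n → X → A} (hG : Integrable G ν)
    (hG' : ∀ j, Integrable (G' j) ν) (h : ∀ x, HasOrbitDeriv αa (G x) fun j => G' j x) :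
    HasOrbitDeriv αa (∫ x, G x ∂ν) fun j => ∫ x, G' j x ∂ν := by
  have e (s : Rn n) : αa s (∫ x, G x ∂ν) = ∫ x, αa s (G x) ∂ν :=
    ((hα.toCLM s).integral_comp_comm hG).symm
  have hO : Integrable (fun x => orbitDeriv fun j => αa 0 (G' j x)) ν := by
    simpa only [hα.map_zero] using integrable_orbitDeriv hG'
  have e' : orbitDeriv (fun j => ∫ x, G' j x ∂ν) =
      ∫ x, orbitDeriv (fun j => αa 0 (G' j x)) ∂ν := by
    simp only [hα.map_zero, integral_orbitDeriv hG']
  have hm (s : Rn n) : AEStronglyMeasurable (fun x => αa s (G x)) ν :=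
    (hα.toCLM s).continuous.comp_aestronglyMeasurable hG.aestronglyMeasurable
  have h0 : Integrable (fun x => αa 0 (G x)) ν := by
    simpa only [hα.map_zero] using hG
  have hb (x : X) (s : Rn n) : ‖orbitDeriv fun j => αa s (G' j x)‖ ≤ ∑ j, ‖G' j x‖ := by
    refine (norm_orbitDeriv_le _).trans_eq ?_
    simp only [hα.norm_map]
  have hbi : Integrable (fun x => ∑ j, ‖G' j x‖) ν :=
    integrable_finsetSum Finset.univ fun j _ => (hG' j).norm
  unfold HasOrbitDeriv
  simp only [e]
  rw [e']
  exact hasFDerivAt_integral_of_dominated_of_fderiv_le (𝕜 := ℝ) (s := Set.univ)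
    (F := fun s x => αa s (G x)) (F' := fun s x => orbitDeriv fun j => αa s (G' j x))
    Filter.univ_mem (Filter.Eventually.of_forall hm) h0 hO.aestronglyMeasurable
    (Filter.Eventually.of_forall fun x s _ => hb x s) hbi
    (Filter.Eventually.of_forall fun x s _ => (h x).hasFDerivAt hα s)

/-- Amplitudes, in terms of recursive symbol bounds. -/
structure IsSymAmplitude (αa : Rn n → (A ≃⋆ₐ[ℂ] A)) (m : ℝ) (a : R2n n → A) : Prop where
  isSmoothFun : IsSmoothFun αa a
  bound : ∀ (c : Fin n → ℕ) (K : ℕ), ∃ C, SymBound m K C fun x => δpow αa c (a x)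

lemma IsAmplitude.isSymAmplitude (hα : IsIsomAction αa) (ha : IsAmplitude αa m a) :
    IsSymAmplitude αa m a :=
  ⟨ha.isSmoothFun, fun c K => ⟨_, ha.symBound_δpow hα K c⟩⟩

namespace IsSymAmplitude

lemma δd (hα : IsIsomAction αa) (ha : IsSymAmplitude αa m a) (j : Fin n) :
    IsSymAmplitude αa m fun x => δd αa j (a x) where
  isSmoothFun := ha.isSmoothFun.δd hα j
  bound c K := by
    simpa only [δpow_δd hα c j (ha.isSmoothFun.mem _)] using ha.bound (c + Pi.single j 1) K

lemma exists_symBound_iterate (hχ : ContDiff ℝ ∞ χc) (hχs : HasCompactSupport χc)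
    (hχ1 : ∀ᶠ x in 𝓝 (0 : R2n n), χc x = 1) (ha : IsSymAmplitude αa m a) (N K : ℕ) :
    ∃ C, SymBound (m - N) K C ((Ltrans χc)^[N] a) := by
  obtain ⟨C', -, H⟩ := exists_symBound_iterate_Ltrans (A := A) hχ hχs hχ1 m N K
  obtain ⟨C, hC⟩ := ha.bound 0 (K + N)
  simp only [δpow_zero] at hC
  exact ⟨_, H C a ha.isSmoothFun.contDiff hC⟩

lemma integrable (hχ : ContDiff ℝ ∞ χc) (hχs : HasCompactSupport χc)
    (hχ1 : ∀ᶠ x in 𝓝 (0 : R2n n), χc x = 1) (ha : IsSymAmplitude αa m a)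
    (hN : m + 2 * n < N) : Integrable (fun x => osc x • ((Ltrans χc)^[N] a) x) volume := by
  obtain ⟨C, hC⟩ := ha.exists_symBound_iterate hχ hχs hχ1 N 0
  exact hC.integrable_osc_smul (by linarith)
    (contDiff_iterate_Ltrans hχ (contDiff_Lcoef hχ hχ1) ha.isSmoothFun.contDiff N).continuous

lemma Josc_succ (hχ : ContDiff ℝ ∞ χc) (hχs : HasCompactSupport χc)
    (hχ1 : ∀ᶠ x in 𝓝 (0 : R2n n), χc x = 1) (ha : IsSymAmplitude αa m a)
    (hN : m + 2 * n < N) : Josc χc (N + 1) a = Josc χc N a := by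
  obtain ⟨C, hC⟩ := ha.exists_symBound_iterate hχ hχs hχ1 N 1
  have := integral_osc_smul_Ltrans hχ hχs hχ1 (by linarith)
    (contDiff_iterate_Ltrans hχ (contDiff_Lcoef hχ hχ1) ha.isSmoothFun.contDiff N) hC
  unfold Josc
  rw [Function.iterate_succ_apply']
  exact congrArg _ this

lemma Josc_eq_of_le (hχ : ContDiff ℝ ∞ χc) (hχs : HasCompactSupport χc)
    (hχ1 : ∀ᶠ x in 𝓝 (0 : R2n n), χc x = 1) (ha : IsSymAmplitude αa m a)
    (hN : m + 2 * n < N) {M : ℕ} (h : N ≤ M) : Josc χc M a = Josc χc N a := by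
  induction M, h using Nat.le_induction with
  | base => rfl
  | succ M hM ih =>
    have : (N : ℝ) ≤ M := Nat.cast_le.2 hM
    rw [ha.Josc_succ hχ hχs hχ1 (by linarith), ih]

lemma Josc_eq (hχ : ContDiff ℝ ∞ χc) (hχs : HasCompactSupport χc)
    (hχ1 : ∀ᶠ x in 𝓝 (0 : R2n n), χc x = 1) (ha : IsSymAmplitude αa m a)
    {N₁ N₂ : ℕ} (h₁ : m + 2 * n < N₁) (h₂ : m + 2 * n < N₂) : Josc χc N₁ a = Josc χc N₂ a := by
  rcases le_total N₁ N₂ with h | h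
  · exact (ha.Josc_eq_of_le hχ hχs hχ1 h₁ h).symm
  · exact ha.Josc_eq_of_le hχ hχs hχ1 h₂ h

lemma hasOrbitDeriv_Josc (hα : IsIsomAction αa) (hχ : ContDiff ℝ ∞ χc)
    (hχs : HasCompactSupport χc) (hχ1 : ∀ᶠ x in 𝓝 (0 : R2n n), χc x = 1)
    (ha : IsSymAmplitude αa m a) (hN : m + 2 * n < N) :
    HasOrbitDeriv αa (Josc χc N a) fun j => Josc χc N fun x => _root_.δd αa j (a x) := by
  have hd := (ha.isSmoothFun.hasDerivations hα).iterate_Ltrans hα hχ (contDiff_Lcoef hχ hχ1) N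
  have := (hasOrbitDeriv_integral hα (ha.integrable hχ hχs hχ1 hN)
    (fun j => (ha.δd hα j).integrable hχ hχs hχ1 hN)
    fun x => (hd.hasOrbitDeriv x).const_smul (osc x)).const_smul
      ((((2 * Real.pi) ^ n)⁻¹ : ℝ) : ℂ)
  simp only [Complex.coe_smul] at this
  exact this

lemma Josc_mem (hα : IsIsomAction αa) (hχ : ContDiff ℝ ∞ χc)
    (hχs : HasCompactSupport χc) (hχ1 : ∀ᶠ x in 𝓝 (0 : R2n n), χc x = 1)
    (ha : IsSymAmplitude αa m a) (hN : m + 2 * n < N) : Josc χc N a ∈ SmoothSet αa := by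
  refine subset_smoothSet (S := {u | ∃ a, IsSymAmplitude αa m a ∧ Josc χc N a = u}) hα ?_
    ⟨a, ha, rfl⟩
  rintro _ ⟨a, ha, rfl⟩
  exact ⟨_, fun j => ⟨_, ha.δd hα j, rfl⟩, ha.hasOrbitDeriv_Josc hα hχ hχs hχ1 hN⟩

lemma δpow_Josc (hα : IsIsomAction αa) (hχ : ContDiff ℝ ∞ χc)
    (hχs : HasCompactSupport χc) (hχ1 : ∀ᶠ x in 𝓝 (0 : R2n n), χc x = 1)
    (ha : IsSymAmplitude αa m a) (hN : m + 2 * n < N) (c : Fin n → ℕ) :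
    δpow αa c (Josc χc N a) = Josc χc N fun x => δpow αa c (a x) := by
  rw [δpow_comp_eq]
  exact (powComp_semiconj_on (S := {a | IsSymAmplitude αa m a}) (φ := Josc χc N)
    (fun j b hb => IsSymAmplitude.δd hα hb j)
    (fun j b hb => (hb.hasOrbitDeriv_Josc hα hχ hχs hχ1 hN).δd_eq j) c a ha).1

end IsSymAmplitude

lemma exists_norm_δpow_Josc_le (hα : IsIsomAction αa) (hχ : ContDiff ℝ ∞ χc)
    (hχs : HasCompactSupport χc) (hχ1 : ∀ᶠ x in 𝓝 (0 : R2n n), χc x = 1)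
    (hN : m + 2 * n < N) (c : Fin n → ℕ) :
    ∃ (N' : ℕ) (C : ℝ), 0 < C ∧ ∀ b : R2n n → A, IsAmplitude αa m b →
      ‖δpow αa c (Josc χc N b)‖ ≤ C * qSemi αa m N' b := by
  obtain ⟨C', hC', H⟩ := exists_symBound_iterate_Ltrans (A := A) hχ hχs hχ1 m N 0
  set W := ∫ x : R2n n, weight x ^ (m - N)
  have hW : 0 ≤ W := integral_nonneg fun x => Real.rpow_nonneg (weight_pos x).le _
  refine ⟨mdeg c + (0 + N), ((2 * Real.pi) ^ n)⁻¹ * (C' * W) + 1, by positivity, fun b hb => ?_⟩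
  have hbs := hb.isSymAmplitude hα
  have hbound := H _ _ (hbs.isSmoothFun.contDiff_δpow c) (hb.symBound_δpow hα (0 + N) c)
  set q := qSemi αa m (mdeg c + (0 + N)) b
  have hq : 0 ≤ q := qSemi_nonneg _ _ _ _
  have hle : ‖∫ x, osc x • ((Ltrans χc)^[N] fun x => δpow αa c (b x)) x‖ ≤ C' * q * W := by
    rw [← integral_const_mul]
    refine norm_integral_le_of_norm_le ((integrable_weight_rpow (by linarith)).const_mul _)
      (Filter.Eventually.of_forall fun x => ?_)
    rw [norm_smul, norm_osc, one_mul]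
    exact hbound x
  rw [hbs.δpow_Josc hα hχ hχs hχ1 hN]
  calc ‖Josc χc N fun x => δpow αa c (b x)‖
      = ((2 * Real.pi) ^ n)⁻¹ * ‖∫ x, osc x • ((Ltrans χc)^[N] fun x => δpow αa c (b x)) x‖ := by
        unfold Josc
        rw [norm_smul, Real.norm_of_nonneg (by positivity)]
        rfl
    _ ≤ ((2 * Real.pi) ^ n)⁻¹ * (C' * q * W) := by gcongr
    _ ≤ (((2 * Real.pi) ^ n)⁻¹ * (C' * W) + 1) * q := by linarith

end Josc

lemma lt_Nfor (n : ℕ) (m : ℝ) : m + 2 * n < Nfor n m := by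
  have := Nat.le_ceil m
  unfold Nfor
  push_cast
  linarith

/-- for an amplitude `a ∈ A^m(ℝⁿ×ℝⁿ;𝒜_θ)` and any integer `N > m+2n`, the map
`(s,ξ) ↦ e^{is·ξ}(L^t)^N[a(s,ξ)]` is Bochner integrable, the value
`J(a) = (2π)^{-n} ∬ e^{is·ξ}(L^t)^N[a(s,ξ)] ds dξ` does not depend on `N`, `J(a) ∈ 𝒜_θ`,
for `m < −2n` it is the plain integral `(2π)^{-n} ∬ e^{is·ξ} a(s,ξ) ds dξ`, and `J` is
continuous on `A^m`: `‖δ^α(J(a))‖ ≤ C q_{N'}^{(m)}(a)`. -/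
theorem statement_13
    {n : ℕ} (hn : 2 ≤ n)
    {A : Type} [NormedRing A] [StarRing A] [CStarRing A] [NormedAlgebra ℂ A]
    [StarModule ℂ A] [CompleteSpace A]
    (αa : Rn n → (A ≃⋆ₐ[ℂ] A))
    (hαadd : ∀ s t (u : A), αa (s + t) u = αa s (αa t u))
    (hα0 : ∀ u : A, αa 0 u = u)
    (hαiso : ∀ s (u : A), ‖αa s u‖ = ‖u‖)
    -- the cut-off `χ ∈ C_c^∞(ℝⁿ×ℝⁿ)`, `χ = 1` near `(0,0)`, entering the operator `L`
    (χc : R2n n → ℝ)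
    (hχsm : ∀ N : ℕ, ContDiff ℝ N χc)
    (hχcp : HasCompactSupport χc)
    (hχ1 : ∀ᶠ x in nhds (0 : R2n n), χc x = 1)
    (m : ℝ) (a : R2n n → A) (ha : IsAmplitude αa m a) :
    -- Bochner integrability of `e^{is·ξ} (L^t)^N[a(s,ξ)]` for every integer `N > m+2n`
    (∀ N : ℕ, m + 2 * n < N →
      MeasureTheory.Integrable
        (fun x : R2n n =>
          Complex.exp (Complex.I * ((∑ j, x.1 j * x.2 j : ℝ) : ℂ)) •
            ((Ltrans χc)^[N] a) x)
        MeasureTheory.volume) ∧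
    -- the value of `J(a)` is independent of the choice of `N > m+2n`
    (∀ N₁ N₂ : ℕ, m + 2 * n < N₁ → m + 2 * n < N₂ →
      Josc χc N₁ a = Josc χc N₂ a) ∧
    -- `J(a)` belongs to `𝒜_θ`
    Josc χc (Nfor n m) a ∈ SmoothSet αa ∧
    -- for `m < −2n`, `J(a)` is the plain (Bochner) integral `(2π)^{-n}∬ e^{is·ξ} a(s,ξ) dsdξ`
    (m < -(2 * n : ℝ) → Josc χc (Nfor n m) a = Josc χc 0 a) ∧
    -- continuity of `J` on `A^m(ℝⁿ×ℝⁿ;𝒜_θ)`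
    (∀ c : Fin n → ℕ, ∃ (N' : ℕ) (C : ℝ), 0 < C ∧
      ∀ b : R2n n → A, IsAmplitude αa m b →
        ‖δpow αa c (Josc χc (Nfor n m) b)‖ ≤ C * qSemi αa m N' b) := by
  have hα : IsIsomAction αa := ⟨hαadd, hα0, hαiso⟩
  have hχ : ContDiff ℝ ∞ χc := contDiff_infty.2 hχsm
  have ha' := ha.isSymAmplitude hα
  exact ⟨fun N hN => ha'.integrable hχ hχcp hχ1 hN,
    fun N₁ N₂ h₁ h₂ => ha'.Josc_eq hχ hχcp hχ1 h₁ h₂,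
    ha'.Josc_mem hα hχ hχcp hχ1 (lt_Nfor n m),
    fun hm => ha'.Josc_eq hχ hχcp hχ1 (lt_Nfor n m) (by push_cast; linarith),
    fun c => exists_norm_δpow_Josc_le hα hχ hχcp hχ1 (lt_Nfor n m) c⟩
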